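/- arXiv:1402.5132 — 2 statements merged into one kernel-verified Lean document; each statement's English description precedes it below -/
import Mathlib

section
/- Let μ ∈ 𝓜_d with support {q_1 < ⋯ < q_{k+1}} and put q_0 = 0, q_{k+2} = 1, m_l = μ([0,q_l]). Then on each strip (q_l, q_{l+1})×ℝ (0 ≤ l ≤ k+1) the partial derivative ∂_s Φ_μ exists and Φ_μ satisfies the Parisi PDE ∂_s Φ_μ(s,x) = −(ζ(s)/2)( ∂_{xx} Φ_μ(s,x) + m_l (∂_x Φ_μ(s,x))² ), noting that μ([0,s]) = m_l for s ∈ [q_l, q_{l+1}). -/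
open MeasureTheory ProbabilityTheory Real Set Filter

noncomputable section

/-- `ξ(s) = ∑_{p≥2} β_p² s^p` (we use `β : ℕ → ℝ` with `β 0 = β 1 = 0`). -/
def xiFn (β : ℕ → ℝ) (s : ℝ) : ℝ := ∑' p : ℕ, β p ^ 2 * s ^ p

/-- `ξ'(s)`. -/
def xiD (β : ℕ → ℝ) (s : ℝ) : ℝ := ∑' p : ℕ, (p : ℝ) * β p ^ 2 * s ^ (p - 1)

/-- `ζ(s) = ξ''(s)`. -/
def zetaFn (β : ℕ → ℝ) (s : ℝ) : ℝ :=
  ∑' p : ℕ, (p : ℝ) * ((p : ℝ) - 1) * β p ^ 2 * s ^ (p - 2)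

/-- admissible sequence of temperature parameters -/
def ValidBeta (β : ℕ → ℝ) : Prop :=
  β 0 = 0 ∧ β 1 = 0 ∧ (∀ p, 0 ≤ β p) ∧ (∃ p, 2 ≤ p ∧ 0 < β p) ∧
    Summable fun p : ℕ => (2 : ℝ) ^ p * β p ^ 2

/-- membership in `𝓜`: a Borel probability measure concentrated on `[0,1]` -/
def MemM (μ : Measure ℝ) : Prop := IsProbabilityMeasure μ ∧ μ (Icc (0 : ℝ) 1)ᶜ = 0

/-- member of `𝓜_d`: finitely supported -/
def FinSupp (μ : Measure ℝ) : Prop := ∃ S : Finset ℝ, μ ((S : Set ℝ))ᶜ = 0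

/-- the distribution function `α(s) = μ([0,s])` -/
def distF (μ : Measure ℝ) (s : ℝ) : ℝ := (μ (Icc 0 s)).toReal

/-- the metric `d(μ,ν) = ∫_0^1 |μ([0,s]) - ν([0,s])| ds` -/
def dM (μ ν : Measure ℝ) : ℝ := ∫ s in (0 : ℝ)..1, |distF μ s - distF ν s|

/-- the smallest atom of `μ` strictly after `s` (or `1` if there is none) -/
def nextPt (μ : Measure ℝ) (s : ℝ) : ℝ :=
  sInf ({q : ℝ | s < q ∧ q ≤ 1 ∧ μ {q} ≠ 0} ∪ {1})

/-- one step of the backward recursion defining the Parisi PDE solution: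
`(1/m) log E exp (m Φ(t, x + z √(ξ'(t) - ξ'(s))))`, interpreted as
`E Φ(t, x + z √(ξ'(t) - ξ'(s)))` when `m = 0`. -/
def gStep (β : ℕ → ℝ) (Φ : ℝ → ℝ → ℝ) (m t s x : ℝ) : ℝ :=
  if m = 0 then ∫ z, Φ t (x + z * Real.sqrt (xiD β t - xiD β s)) ∂(gaussianReal 0 1)
  else m⁻¹ * Real.log
    (∫ z, Real.exp (m * Φ t (x + z * Real.sqrt (xiD β t - xiD β s))) ∂(gaussianReal 0 1))

/-- `Φ` is the Parisi PDE solution of a finitely supported `μ`. -/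
def IsAtomicSol (β : ℕ → ℝ) (μ : Measure ℝ) (Φ : ℝ → ℝ → ℝ) : Prop :=
  (∀ x : ℝ, Φ 1 x = Real.log (Real.cosh x)) ∧
  (∀ s ∈ Ico (0 : ℝ) 1, ∀ x : ℝ, Φ s x = gStep β Φ (distF μ s) (nextPt μ s) s x)

/-- `Φ` is the Parisi family `μ ↦ Φ_μ`: it satisfies the backward recursion on `𝓜_d`
and is `d`-continuous on `𝓜` (uniformly in `(s,x) ∈ [0,1] × ℝ`). -/
def IsParisiFamily (β : ℕ → ℝ) (Φ : Measure ℝ → ℝ → ℝ → ℝ) : Prop :=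
  (∀ μ, MemM μ → FinSupp μ → IsAtomicSol β μ (Φ μ)) ∧
  (∀ μ, MemM μ → ∀ ε : ℝ, 0 < ε → ∃ δ : ℝ, 0 < δ ∧ ∀ ν, MemM ν → dM μ ν < δ →
      ∀ s ∈ Icc (0 : ℝ) 1, ∀ x : ℝ, |Φ μ s x - Φ ν s x| < ε)

/-- `B` is a standard Brownian motion under `P`. -/
def IsStdBM {Ω : Type*} [MeasurableSpace Ω] (P : Measure Ω) (B : ℝ → Ω → ℝ) : Prop :=
  (∀ t : ℝ, Measurable (B t)) ∧
  (∀ᵐ ω ∂P, B 0 ω = 0) ∧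
  (∀ᵐ ω ∂P, Continuous fun t => B t ω) ∧
  (∀ s t : ℝ, 0 ≤ s → s ≤ t →
    Measure.map (fun ω => B t ω - B s ω) P = gaussianReal 0 (Real.toNNReal (t - s))) ∧
  (∀ s t : ℝ, 0 ≤ s → s ≤ t →
    Indep (MeasurableSpace.comap (fun ω => B t ω - B s ω) inferInstance)
      (⨆ v ∈ Icc (0 : ℝ) s, MeasurableSpace.comap (B v) inferInstance) P)

/-- the space `𝓓[s,t]`: progressively measurable processes bounded by `1` on `[s,t]` -/
def InD {Ω : Type*} {mΩ : MeasurableSpace Ω} (𝓕 : Filtration ℝ mΩ) (s t : ℝ)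
    (u : ℝ → Ω → ℝ) : Prop :=
  ProgMeasurable 𝓕 u ∧ ∀ r ∈ Icc s t, ∀ ω, |u r ω| ≤ 1

/-- the norm `‖u‖ = (E ∫_s^t u(r)² dr)^{1/2}` on `𝓓[s,t]` -/
def normD {Ω : Type*} [MeasurableSpace Ω] (P : Measure Ω) (s t : ℝ)
    (u : ℝ → Ω → ℝ) : ℝ :=
  Real.sqrt (∫ ω, (∫ r in s..t, (u r ω) ^ 2) ∂P)

/-- the functional
`F^{s,t}(u,x) = E[Φ_μ(t, x + ∫_s^t α ζ u dr + W(t) - W(s)) - (1/2)∫_s^t α ζ u² dr]`,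
where `W r = B (ξ' r)`. -/
def Ffn {Ω : Type*} [MeasurableSpace Ω] (P : Measure Ω) (β : ℕ → ℝ) (μ : Measure ℝ)
    (Φ : ℝ → ℝ → ℝ) (W : ℝ → Ω → ℝ) (s t : ℝ) (u : ℝ → Ω → ℝ) (x : ℝ) : ℝ :=
  ∫ ω, (Φ t (x + (∫ r in s..t, distF μ r * zetaFn β r * u r ω) + (W t ω - W s ω))
      - (1 / 2) * ∫ r in s..t, distF μ r * zetaFn β r * (u r ω) ^ 2) ∂P


/-! ### Power series -/

lemma valid_summable {β : ℕ → ℝ} (hβ : ValidBeta β) {s : ℝ} (hs0 : 0 ≤ s) (hs1 : s ≤ 1) :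
    Summable fun p : ℕ => (p : ℝ) * β p ^ 2 * s ^ (p - 1) := by
  obtain ⟨_, _, _, _, h⟩ := hβ
  refine Summable.of_nonneg_of_le (fun p => by positivity) (fun p => ?_) h
  have h1 : (p : ℝ) ≤ 2 ^ p := by exact_mod_cast (Nat.lt_two_pow_self (n := p)).le
  have h2 : s ^ (p - 1) ≤ 1 := pow_le_one₀ hs0 hs1
  calc (p : ℝ) * β p ^ 2 * s ^ (p - 1) ≤ (p : ℝ) * β p ^ 2 * 1 := by gcongr
    _ ≤ 2 ^ p * β p ^ 2 := by rw [mul_one]; gcongr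

lemma xiD_lt {β : ℕ → ℝ} (hβ : ValidBeta β) {s t : ℝ} (hs0 : 0 ≤ s) (hst : s < t) (ht : t ≤ 1) :
    xiD β s < xiD β t := by
  obtain ⟨p, hp, hp0⟩ := hβ.2.2.2.1
  unfold xiD
  refine Summable.tsum_lt_tsum_of_nonneg (i := p) (fun b => by positivity) (fun b => ?_) ?_
    (valid_summable hβ (hs0.trans hst.le) ht)
  · gcongr
  · have : s ^ (p - 1) < t ^ (p - 1) := pow_lt_pow_left₀ hst hs0 (by omega)
    have : (0 : ℝ) < p := by exact_mod_cast (by omega : 0 < p)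
    gcongr

lemma xiD_deriv {β : ℕ → ℝ} (hβ : ValidBeta β) {s : ℝ} (hs : s ∈ Ioo (0 : ℝ) 1) :
    HasDerivAt (xiD β) (zetaFn β s) s := by
  have hu : Summable fun p : ℕ => 2 * ((2 : ℝ) ^ p * β p ^ 2) := hβ.2.2.2.2.mul_left 2
  unfold xiD zetaFn
  refine hasDerivAt_tsum_of_isPreconnected (t := Ioo (0 : ℝ) 1) (y₀ := s)
    (g := fun (p : ℕ) (s : ℝ) => (p : ℝ) * β p ^ 2 * s ^ (p - 1))
    (g' := fun (p : ℕ) (s : ℝ) => (p : ℝ) * ((p : ℝ) - 1) * β p ^ 2 * s ^ (p - 2)) hu isOpen_Ioo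
    isPreconnected_Ioo ?_ ?_ hs (valid_summable hβ hs.1.le hs.2.le) hs
  · intro p y hy
    rcases Nat.eq_zero_or_pos p with rfl | hp
    · simpa using hasDerivAt_const y (0 : ℝ)
    · have := (hasDerivAt_pow (p - 1) y).const_mul ((p : ℝ) * β p ^ 2)
      convert! this using 1
      rw [Nat.cast_sub hp, Nat.sub_sub]
      push_cast; ring
  · intro p y hy
    have h2 : y ^ (p - 2) ≤ 1 := pow_le_one₀ hy.1.le hy.2.le
    have h0 : 0 ≤ y ^ (p - 2) := pow_nonneg hy.1.le _
    have h3 : (p : ℝ) * ((p : ℝ) - 1) = 2 * (p.choose 2 : ℝ) := by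
      rw [Nat.cast_choose_two]; ring
    have h4 : (p.choose 2 : ℝ) ≤ 2 ^ p := by exact_mod_cast Nat.choose_le_two_pow p 2
    rw [h3, Real.norm_of_nonneg (by positivity)]
    calc 2 * (p.choose 2 : ℝ) * β p ^ 2 * y ^ (p - 2) ≤ 2 * (p.choose 2 : ℝ) * β p ^ 2 * 1 := by
          gcongr
      _ ≤ 2 * (2 ^ p * β p ^ 2) := by
          rw [mul_one, mul_assoc]; gcongr

/-! ### The heat kernel -/

/-- heat kernel -/
def heatK (v x y : ℝ) : ℝ := (√(2 * π * v))⁻¹ * Real.exp (-(y - x) ^ 2 / (2 * v))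

lemma heatK_nonneg (v x y : ℝ) : 0 ≤ heatK v x y := by unfold heatK; positivity

lemma heatK_cont (v x : ℝ) : Continuous (heatK v x) := by unfold heatK; fun_prop

lemma heatK_deriv_x (v x y : ℝ) (hv : 0 < v) :
    HasDerivAt (fun x => heatK v x y) (heatK v x y * ((y - x) / v)) x := by
  have h1 : HasDerivAt (fun x => -(y - x) ^ 2 / (2 * v)) ((y - x) / v) x := by
    have := ((((hasDerivAt_id x).const_sub y).pow 2).neg).div_const (2 * v)
    convert! this using 1
    simp; field_simp
  have := (h1.exp).const_mul (√(2 * π * v))⁻¹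
  convert! this using 1
  unfold heatK; ring

lemma heatK_deriv_xx (v x y : ℝ) (hv : 0 < v) :
    HasDerivAt (fun x => heatK v x y * ((y - x) / v))
      (heatK v x y * ((y - x) ^ 2 / v ^ 2 - 1 / v)) x := by
  have h1 : HasDerivAt (fun x => (y - x) / v) (-1 / v) x := by
    simpa using ((hasDerivAt_id x).const_sub y).div_const v
  convert! (heatK_deriv_x v x y hv).mul h1 using 1
  ring

lemma heatK_deriv_v (v x y : ℝ) (hv : 0 < v) :
    HasDerivAt (fun v => heatK v x y)
      (heatK v x y * ((1 / 2) * ((y - x) ^ 2 / v ^ 2 - 1 / v))) v := by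
  have hpos : 0 < 2 * π * v := by positivity
  have h0 : HasDerivAt (fun v : ℝ => 2 * π * v) (2 * π) v := by
    simpa using (hasDerivAt_id v).const_mul (2 * π)
  have h1 : HasDerivAt (fun v => (√(2 * π * v))⁻¹) _ v :=
    (h0.sqrt hpos.ne').inv (Real.sqrt_ne_zero'.2 hpos)
  have h2 : HasDerivAt (fun v => -(y - x) ^ 2 / (2 * v)) ((y - x) ^ 2 / (2 * v ^ 2)) v := by
    have h3 : HasDerivAt (fun v : ℝ => 2 * v) 2 v := by
      simpa using (hasDerivAt_id v).const_mul (2 : ℝ)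
    have := (hasDerivAt_const v (-(y - x) ^ 2)).div h3 (by positivity)
    convert! this using 1
    field_simp; ring
  convert! h1.mul h2.exp using 1
  unfold heatK
  have hs : √(2 * π * v) ≠ 0 := Real.sqrt_ne_zero'.2 hpos
  have hsq : √(2 * π * v) ^ 2 = 2 * π * v := Real.sq_sqrt hpos.le
  have e1 : -(2 * π / (2 * √(2 * π * v))) / √(2 * π * v) ^ 2 = (√(2 * π * v))⁻¹ * (-(1 / (2 * v))) := by
    rw [hsq]; field_simp
  rw [e1]
  field_simp
  ring

lemma heat_dom (F : ℝ → ℝ) (A B : ℝ) (hB : 0 ≤ B) (hF : ∀ y, |F y| ≤ A * Real.exp (B * |y|))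
    (v₀ x₀ : ℝ) (hv₀ : 0 < v₀) :
    ∃ M c : ℝ, 0 < c ∧ ∀ y, ∀ v ∈ Ioo (v₀ / 2) (2 * v₀), ∀ x ∈ Metric.ball x₀ 1,
      |F y| * heatK v x y * (1 + |y - x|) ^ 2 ≤ M * Real.exp (-c * (y - x₀) ^ 2) := by
  have hA : 0 ≤ A := by simpa using (abs_nonneg _).trans (hF 0)
  set c : ℝ := 1 / (16 * v₀) with hc
  have hcp : 0 < c := by positivity
  refine ⟨A * (√(2 * π * (v₀ / 2)))⁻¹ *
    Real.exp (B * |x₀| + 2 + 1 / (4 * v₀) + (B + 2) ^ 2 / (4 * c)), c, hcp, ?_⟩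
  intro y v hv x hx
  have hvp : 0 < v := by have := hv.1; linarith
  rw [Metric.mem_ball, Real.dist_eq] at hx
  set w := y - x₀ with hw
  have h1 : |y| ≤ |x₀| + |w| := by
    have : y = x₀ + w := by rw [hw]; ring
    rw [this]; exact abs_add_le _ _
  have h2 : |y - x| ≤ |w| + 1 := by
    have : y - x = w + (x₀ - x) := by rw [hw]; ring
    rw [this]
    refine (abs_add_le _ _).trans ?_
    rw [abs_sub_comm x₀ x]; linarith
  have h3 : (1 + |y - x|) ^ 2 ≤ Real.exp (2 * (|w| + 1)) := by
    rw [two_mul, Real.exp_add, ← sq]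
    have := Real.add_one_le_exp (|y - x|)
    have h' : Real.exp |y - x| ≤ Real.exp (|w| + 1) := Real.exp_le_exp.2 h2
    gcongr
    linarith
  have h4 : w ^ 2 / 2 - 1 ≤ (y - x) ^ 2 := by
    have e : y - x = w + (x₀ - x) := by rw [hw]; ring
    have : (x₀ - x) ^ 2 ≤ 1 := by
      rw [sq_le_one_iff_abs_le_one, abs_sub_comm]; exact hx.le
    rw [e]
    nlinarith [sq_nonneg (w + 2 * (x₀ - x))]
  have h5 : -(y - x) ^ 2 / (2 * v) ≤ 1 / (4 * v₀) - 2 * c * w ^ 2 := by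
    have a1 : (y - x) ^ 2 / (4 * v₀) ≤ (y - x) ^ 2 / (2 * v) := by
      have := hv.2
      exact div_le_div_of_nonneg_left (sq_nonneg _) (by positivity) (by linarith)
    have a2 : (w ^ 2 / 2 - 1) / (4 * v₀) ≤ (y - x) ^ 2 / (4 * v₀) := by gcongr
    have a3 : (w ^ 2 / 2 - 1) / (4 * v₀) = 2 * c * w ^ 2 - 1 / (4 * v₀) := by
      rw [hc]; field_simp; ring
    rw [neg_div]; linarith
  have h6 : heatK v x y ≤ (√(2 * π * (v₀ / 2)))⁻¹ * Real.exp (1 / (4 * v₀) - 2 * c * w ^ 2) := by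
    unfold heatK
    have := hv.1
    gcongr
  have h7 : (B + 2) * |w| ≤ c * w ^ 2 + (B + 2) ^ 2 / (4 * c) := by
    have : (B + 2) ^ 2 / (4 * c) = ((B + 2) / (2 * c)) ^ 2 * c := by field_simp; ring
    rw [this]
    have e2 : B + 2 = 2 * c * ((B + 2) / (2 * c)) := by field_simp
    rw [← sq_abs w]
    nlinarith [mul_nonneg hcp.le (sq_nonneg (|w| - (B + 2) / (2 * c))), abs_nonneg w]
  calc |F y| * heatK v x y * (1 + |y - x|) ^ 2
      ≤ (A * Real.exp (B * (|x₀| + |w|))) *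
        ((√(2 * π * (v₀ / 2)))⁻¹ * Real.exp (1 / (4 * v₀) - 2 * c * w ^ 2)) *
          Real.exp (2 * (|w| + 1)) := by
        have := heatK_nonneg v x y
        have h8 : |F y| ≤ A * Real.exp (B * (|x₀| + |w|)) :=
          (hF y).trans (by gcongr)
        gcongr
    _ = A * (√(2 * π * (v₀ / 2)))⁻¹ * Real.exp (B * (|x₀| + |w|) + (1 / (4 * v₀) - 2 * c * w ^ 2)
          + 2 * (|w| + 1)) := by
        rw [Real.exp_add, Real.exp_add]; ring
    _ ≤ A * (√(2 * π * (v₀ / 2)))⁻¹ * Real.exp ((B * |x₀| + 2 + 1 / (4 * v₀) +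
          (B + 2) ^ 2 / (4 * c)) + (-c * w ^ 2)) := by
        refine mul_le_mul_of_nonneg_left (Real.exp_le_exp.2 ?_) (by positivity)
        linarith
    _ = _ := by rw [Real.exp_add]; ring

/-- General differentiation under the integral for kernels `heatK * polynomial`. -/
lemma heat_int (F : ℝ → ℝ) (hFc : Continuous F) (A B : ℝ) (hB : 0 ≤ B)
    (hF : ∀ y, |F y| ≤ A * Real.exp (B * |y|)) (v x : ℝ) (hv : 0 < v)
    (P : ℝ → ℝ) (hP : Continuous P) (D : ℝ) (hD : ∀ y, |P y| ≤ D * (1 + |y - x|) ^ 2) :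
    Integrable fun y => F y * (heatK v x y * P y) := by
  obtain ⟨M, c, hc, h⟩ := heat_dom F A B hB hF v x hv
  have hg : Integrable fun y => D * (M * Real.exp (-c * (y - x) ^ 2)) :=
    (((integrable_exp_neg_mul_sq hc).comp_sub_right x).const_mul M).const_mul D
  have hD0 : 0 ≤ D := by
    have := (abs_nonneg _).trans (hD x)
    simpa using this
  refine hg.mono' ((hFc.mul ((heatK_cont v x).mul hP)).aestronglyMeasurable) ?_
  refine Eventually.of_forall fun y => ?_
  have h1 := h y v ⟨by linarith, by linarith⟩ x (by simp)
  have hk := heatK_nonneg v x y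
  rw [Real.norm_eq_abs, abs_mul, abs_mul, abs_of_nonneg hk]
  calc |F y| * (heatK v x y * |P y|) ≤ |F y| * (heatK v x y * (D * (1 + |y - x|) ^ 2)) := by
        have := hD y; gcongr
    _ = D * (|F y| * heatK v x y * (1 + |y - x|) ^ 2) := by ring
    _ ≤ _ := by gcongr

/-- the three derivatives -/
lemma heat_main (F : ℝ → ℝ) (hFc : Continuous F) (A B : ℝ) (hB : 0 ≤ B)
    (hF : ∀ y, |F y| ≤ A * Real.exp (B * |y|)) (v x : ℝ) (hv : 0 < v) :
    HasDerivAt (fun x => ∫ y, F y * heatK v x y) (∫ y, F y * (heatK v x y * ((y - x) / v))) x ∧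
    HasDerivAt (fun x => ∫ y, F y * (heatK v x y * ((y - x) / v)))
      (∫ y, F y * (heatK v x y * ((y - x) ^ 2 / v ^ 2 - 1 / v))) x ∧
    HasDerivAt (fun v => ∫ y, F y * heatK v x y)
      ((1 / 2) * ∫ y, F y * (heatK v x y * ((y - x) ^ 2 / v ^ 2 - 1 / v))) v := by
  obtain ⟨M, c, hc, h⟩ := heat_dom F A B hB hF v x hv
  have hg : ∀ D : ℝ, Integrable fun y => D * (M * Real.exp (-c * (y - x) ^ 2)) := fun D =>
    (((integrable_exp_neg_mul_sq hc).comp_sub_right x).const_mul M).const_mul D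
  have hb1 : ∀ v' y x' : ℝ, v / 2 < v' → |(y - x') / v'| ≤ (2 / v) * (1 + |y - x'|) ^ 2 := by
    intro v' y x' hv'
    have hv'p : 0 < v' := by linarith
    rw [abs_div, abs_of_pos hv'p]
    have e1 : 1 / v' ≤ 2 / v := by
      rw [div_le_div_iff₀ hv'p hv]; linarith
    have e2 : |y - x'| ≤ (1 + |y - x'|) ^ 2 := by nlinarith [abs_nonneg (y - x')]
    calc |y - x'| / v' = (1 / v') * |y - x'| := by ring
      _ ≤ _ := by gcongr
  have hb2 : ∀ v' y x' : ℝ, v / 2 < v' →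
      |(y - x') ^ 2 / v' ^ 2 - 1 / v'| ≤ ((2 / v) ^ 2 + 2 / v) * (1 + |y - x'|) ^ 2 := by
    intro v' y x' hv'
    have hv'p : 0 < v' := by linarith
    have e1 : 1 / v' ≤ 2 / v := by
      rw [div_le_div_iff₀ hv'p hv]; linarith
    have e2 : (y - x') ^ 2 ≤ (1 + |y - x'|) ^ 2 := by
      rw [← sq_abs (y - x')]; nlinarith [abs_nonneg (y - x')]
    have e3 : 1 ≤ (1 + |y - x'|) ^ 2 := by nlinarith [abs_nonneg (y - x')]
    refine (abs_sub _ _).trans ?_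
    rw [abs_of_nonneg (by positivity), abs_of_nonneg (by positivity), add_mul]
    have e4 : (y - x') ^ 2 / v' ^ 2 = (1 / v') ^ 2 * (y - x') ^ 2 := by ring
    rw [e4]
    refine add_le_add (by gcongr) ?_
    calc 1 / v' = 1 / v' * 1 := by ring
      _ ≤ _ := by gcongr
  have hvv : v / 2 < v := by linarith
  have hmem : v ∈ Ioo (v / 2) (2 * v) := ⟨hvv, by linarith⟩
  have key : ∀ v' ∈ Ioo (v / 2) (2 * v), ∀ x' ∈ Metric.ball x 1, ∀ y D p : ℝ, 
      0 ≤ D → |p| ≤ D * (1 + |y - x'|) ^ 2 →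
      ‖F y * (heatK v' x' y * p)‖ ≤ D * (M * Real.exp (-c * (y - x) ^ 2)) := by
    intro v' hv' x' hx' y D p hD hp
    have h1 := h y v' hv' x' hx'
    have hk := heatK_nonneg v' x' y
    rw [Real.norm_eq_abs, abs_mul, abs_mul, abs_of_nonneg hk]
    calc |F y| * (heatK v' x' y * |p|) ≤ |F y| * (heatK v' x' y * (D * (1 + |y - x'|) ^ 2)) := by
          gcongr
      _ = D * (|F y| * heatK v' x' y * (1 + |y - x'|) ^ 2) := by ring
      _ ≤ _ := by gcongr
  have hm : ∀ v' x', AEStronglyMeasurable (fun y => F y * heatK v' x' y) := fun v' x' =>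
    (hFc.mul (heatK_cont v' x')).aestronglyMeasurable
  have hm1 : ∀ v' x', AEStronglyMeasurable (fun y => F y * (heatK v' x' y * ((y - x') / v'))) :=
    fun v' x' => (hFc.mul ((heatK_cont v' x').mul (by fun_prop))).aestronglyMeasurable
  have hm2 : ∀ v' x', AEStronglyMeasurable
      (fun y => F y * (heatK v' x' y * ((y - x') ^ 2 / v' ^ 2 - 1 / v'))) :=
    fun v' x' => (hFc.mul ((heatK_cont v' x').mul (by fun_prop))).aestronglyMeasurable
  have hi0 : Integrable fun y => F y * heatK v x y := by
    have := heat_int F hFc A B hB hF v x hv (fun _ => 1) continuous_const 1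
      (fun y => by rw [abs_one]; nlinarith [abs_nonneg (y - x)])
    simpa using this
  have hi1 : Integrable fun y => F y * (heatK v x y * ((y - x) / v)) :=
    heat_int F hFc A B hB hF v x hv (fun y => (y - x) / v) (by fun_prop) (2 / v)
      (fun y => hb1 v y x hvv)
  refine ⟨?_, ?_, ?_⟩
  · refine (hasDerivAt_integral_of_dominated_loc_of_deriv_le
      (F := fun x y => F y * heatK v x y) (F' := fun x y => F y * (heatK v x y * ((y - x) / v)))
      (Metric.ball_mem_nhds x one_pos) (Eventually.of_forall fun x' => hm v x') hi0 (hm1 v x)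
      (Eventually.of_forall fun y x' hx' => ?_) (hg (2 / v))
      (Eventually.of_forall fun y x' hx' => ?_)).2
    · exact key v hmem x' hx' y _ _ (by positivity) (hb1 v y x' hvv)
    · exact (heatK_deriv_x v x' y hv).const_mul _
  · refine (hasDerivAt_integral_of_dominated_loc_of_deriv_le
      (F := fun x y => F y * (heatK v x y * ((y - x) / v)))
      (F' := fun x y => F y * (heatK v x y * ((y - x) ^ 2 / v ^ 2 - 1 / v)))
      (Metric.ball_mem_nhds x one_pos) (Eventually.of_forall fun x' => hm1 v x') hi1 (hm2 v x)
      (Eventually.of_forall fun y x' hx' => ?_) (hg ((2 / v) ^ 2 + 2 / v))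
      (Eventually.of_forall fun y x' hx' => ?_)).2
    · exact key v hmem x' hx' y _ _ (by positivity) (hb2 v y x' hvv)
    · exact (heatK_deriv_xx v x' y hv).const_mul _
  · have := (hasDerivAt_integral_of_dominated_loc_of_deriv_le
      (F := fun v y => F y * heatK v x y)
      (F' := fun v y => F y * (heatK v x y * ((1 / 2) * ((y - x) ^ 2 / v ^ 2 - 1 / v))))
      (bound := fun y => ((2 / v) ^ 2 + 2 / v) * (M * Real.exp (-c * (y - x) ^ 2)))
      (μ := volume)
      (Ioo_mem_nhds hmem.1 hmem.2) (Eventually.of_forall fun v' => hm v' x) hi0 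
      ((hFc.mul ((heatK_cont v x).mul (by fun_prop))).aestronglyMeasurable)
      (Eventually.of_forall fun y v' hv' => ?_) (hg _)
      (Eventually.of_forall fun y v' hv' => ?_)).2
    · convert! this using 1
      rw [← integral_const_mul]
      congr 1; ext y; ring
    · refine key v' hv' x (by simp) y _ _ (by positivity) ?_
      have := hb2 v' y x hv'.1
      rw [abs_mul]
      refine le_trans ?_ this
      rw [abs_of_pos (by norm_num : (0 : ℝ) < 1 / 2)]
      linarith [abs_nonneg ((y - x) ^ 2 / v' ^ 2 - 1 / v')]
    · exact (heatK_deriv_v v' x y (by linarith [hv'.1])).const_mul _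

lemma gauss_eq_heat (F : ℝ → ℝ) (hFc : Continuous F) (v x : ℝ) (hv : 0 < v) :
    ∫ z, F (x + z * √v) ∂(gaussianReal 0 1) = ∫ y, F y * heatK v x y := by
  have hmap : (gaussianReal 0 1).map (fun z => x + z * √v) = gaussianReal x v.toNNReal := by
    have h1 := gaussianReal_map_mul_const (μ := 0) (v := 1) (√v)
    have h2 := gaussianReal_map_const_add (μ := 0) (v := v.toNNReal) x
    have h3 : (fun z => x + z * √v) = (fun z => x + z) ∘ (fun z => z * √v) := rfl
    rw [h3, ← Measure.map_map (by fun_prop) (by fun_prop), h1]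
    have : (NNReal.mk (√v ^ 2) (sq_nonneg _) * 1 : NNReal) = v.toNNReal := by
      ext; simp [Real.sq_sqrt hv.le, hv.le]
    rw [this, mul_zero, h2, zero_add]
  rw [← integral_map (φ := fun z => x + z * √v) (f := F) (by fun_prop)
    hFc.aestronglyMeasurable, hmap,
    integral_gaussianReal_eq_integral_smul (by simpa using hv)]
  congr 1; ext y
  simp only [gaussianPDFReal, heatK, smul_eq_mul, Real.coe_toNNReal v hv.le]
  ring

/-! ### Lipschitz property -/

lemma lip_cont {f : ℝ → ℝ} (hf : ∀ x y, f x ≤ f y + |x - y|) : Continuous f := by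
  have : LipschitzWith 1 f := LipschitzWith.of_le_add fun x y => by
    simpa [Real.dist_eq] using hf x y
  exact this.continuous

lemma gauss_exp_abs (c : ℝ) : Integrable (fun z : ℝ => Real.exp (c * |z|)) (gaussianReal 0 1) := by
  refine integrable_exp_mul_abs (X := fun z : ℝ => z) (integrable_exp_mul_gaussianReal c) ?_
  exact integrable_exp_mul_gaussianReal (-c)

lemma lip_exp_int {f : ℝ → ℝ} (hf : ∀ x y, f x ≤ f y + |x - y|) (m : ℝ) (hm : 0 ≤ m) (σ : ℝ)
    (x : ℝ) : Integrable (fun z => Real.exp (m * f (x + z * σ))) (gaussianReal 0 1) := by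
  have hc := lip_cont hf
  refine ((gauss_exp_abs (m * |σ|)).const_mul (Real.exp (m * f x))).mono'
    (Continuous.aestronglyMeasurable (by fun_prop)) (Eventually.of_forall fun z => ?_)
  rw [Real.norm_of_nonneg (Real.exp_pos _).le, ← Real.exp_add]
  refine Real.exp_le_exp.2 ?_
  have := hf (x + z * σ) x
  have e : |x + z * σ - x| = |z| * |σ| := by rw [add_sub_cancel_left, abs_mul]
  rw [e] at this
  nlinarith [mul_le_mul_of_nonneg_left this hm]

lemma lip_int {f : ℝ → ℝ} (hf : ∀ x y, f x ≤ f y + |x - y|) (σ : ℝ)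
    (x : ℝ) : Integrable (fun z => f (x + z * σ)) (gaussianReal 0 1) := by
  have hc := lip_cont hf
  refine ((gauss_exp_abs |σ|).const_mul 1 |>.add (integrable_const |f x|)).mono'
    (Continuous.aestronglyMeasurable (by fun_prop)) (Eventually.of_forall fun z => ?_)
  have h1 := hf (x + z * σ) x
  have h2 := hf x (x + z * σ)
  have e : |x + z * σ - x| = |σ| * |z| := by rw [add_sub_cancel_left, abs_mul, mul_comm]
  have e' : |x - (x + z * σ)| = |σ| * |z| := by rw [abs_sub_comm, e]
  rw [e] at h1
  rw [e'] at h2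
  have h3 := Real.add_one_le_exp (|σ| * |z|)
  have h4 := le_abs_self (f x)
  have h5 := neg_abs_le (f x)
  simp only [Pi.add_apply, one_mul]
  rw [Real.norm_eq_abs, abs_le]
  constructor <;> linarith

lemma gStep_lip (β : ℕ → ℝ) (Φ : ℝ → ℝ → ℝ) (m t s : ℝ) (hm : 0 ≤ m)
    (hf : ∀ x y, Φ t x ≤ Φ t y + |x - y|) :
    ∀ x y, gStep β Φ m t s x ≤ gStep β Φ m t s y + |x - y| := by
  intro x y
  unfold gStep
  set σ := √(xiD β t - xiD β s)
  have hp : ∀ z, Φ t (x + z * σ) ≤ Φ t (y + z * σ) + |x - y| := by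
    intro z
    have := hf (x + z * σ) (y + z * σ)
    rwa [add_sub_add_right_eq_sub] at this
  split_ifs with h
  · calc ∫ z, Φ t (x + z * σ) ∂(gaussianReal 0 1)
        ≤ ∫ z, (Φ t (y + z * σ) + |x - y|) ∂(gaussianReal 0 1) :=
          integral_mono (lip_int hf σ x) ((lip_int hf σ y).add (integrable_const _)) hp
      _ = _ := by
          rw [integral_add (lip_int hf σ y) (integrable_const _)]
          simp
  · have hmp : 0 < m := lt_of_le_of_ne hm (Ne.symm h)
    have hix := lip_exp_int hf m hm σ x
    have hiy := lip_exp_int hf m hm σ y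
    have hpos : ∀ w, 0 < ∫ z, Real.exp (m * Φ t (w + z * σ)) ∂(gaussianReal 0 1) := fun w =>
      integral_exp_pos (lip_exp_int hf m hm σ w)
    have h1 : ∫ z, Real.exp (m * Φ t (x + z * σ)) ∂(gaussianReal 0 1) ≤
        Real.exp (m * |x - y|) * ∫ z, Real.exp (m * Φ t (y + z * σ)) ∂(gaussianReal 0 1) := by
      rw [← integral_const_mul]
      refine integral_mono hix (hiy.const_mul _) fun z => ?_
      simp only [← Real.exp_add]
      refine Real.exp_le_exp.2 ?_
      nlinarith [mul_le_mul_of_nonneg_left (hp z) hm]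
    have h2 := Real.log_le_log (hpos x) h1
    rw [Real.log_mul (Real.exp_pos _).ne' (hpos y).ne', Real.log_exp] at h2
    have h3 := mul_le_mul_of_nonneg_left h2 (inv_nonneg.2 hm)
    rw [mul_add, inv_mul_cancel_left₀ h] at h3
    linarith

lemma logcosh_lip (x y : ℝ) : Real.log (Real.cosh x) ≤ Real.log (Real.cosh y) + |x - y| := by
  have h : Real.cosh x ≤ Real.cosh y * Real.exp |x - y| := by
    rw [Real.cosh_eq, Real.cosh_eq]
    have h1 : Real.exp x ≤ Real.exp y * Real.exp |x - y| := by
      rw [← Real.exp_add]; refine Real.exp_le_exp.2 ?_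
      linarith [le_abs_self (x - y)]
    have h2 : Real.exp (-x) ≤ Real.exp (-y) * Real.exp |x - y| := by
      rw [← Real.exp_add]; refine Real.exp_le_exp.2 ?_
      linarith [neg_abs_le (x - y)]
    linarith
  have := Real.log_le_log (Real.cosh_pos x) h
  rwa [Real.log_mul (Real.cosh_pos y).ne' (Real.exp_pos _).ne', Real.log_exp] at this

lemma atoms_mem {μ : Measure ℝ} {S : Finset ℝ} (hS : μ ((S : Set ℝ))ᶜ = 0) {q : ℝ}
    (hq : μ {q} ≠ 0) : q ∈ S := by
  by_contra h
  exact hq (measure_mono_null (by simpa using h) hS)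

lemma nextPt_mem {μ : Measure ℝ} {S : Finset ℝ} (hS : μ ((S : Set ℝ))ᶜ = 0) (s : ℝ) :
    nextPt μ s ∈ ({q : ℝ | s < q ∧ q ≤ 1 ∧ μ {q} ≠ 0} ∪ {1}) := by
  unfold nextPt
  refine Set.Nonempty.csInf_mem ⟨1, Or.inr rfl⟩ ?_
  refine Set.Finite.union (S.finite_toSet.subset fun q hq => atoms_mem hS hq.2.2)
    (Set.finite_singleton _)

lemma sol_lip {β : ℕ → ℝ} {μ : Measure ℝ} {Φ : ℝ → ℝ → ℝ} (h : IsAtomicSol β μ Φ)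
    {S : Finset ℝ} (hS : μ ((S : Set ℝ))ᶜ = 0) :
    ∀ n : ℕ, ∀ s ∈ Icc (0 : ℝ) 1, (S.filter (s < ·)).card = n →
      ∀ x y, Φ s x ≤ Φ s y + |x - y| := by
  intro n
  induction n using Nat.strong_induction_on with
  | _ n ih =>
    intro s hs hn
    rcases eq_or_lt_of_le hs.2 with h1 | h1
    · intro x y
      rw [h1, h.1, h.1]; exact logcosh_lip x y
    · have ht : ∀ x y, Φ (nextPt μ s) x ≤ Φ (nextPt μ s) y + |x - y| := by
        rcases nextPt_mem hS s with ht | ht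
        · obtain ⟨h2, h3, h4⟩ := ht
          refine ih _ ?_ (nextPt μ s) ⟨hs.1.trans h2.le, h3⟩ rfl
          rw [← hn]
          refine Finset.card_lt_card ?_
          rw [Finset.ssubset_iff_of_subset]
          · exact ⟨nextPt μ s, by simp [atoms_mem hS h4, h2], by simp⟩
          · intro q hq
            simp only [Finset.mem_filter] at hq ⊢
            exact ⟨hq.1, h2.trans hq.2⟩
        · intro x y
          rw [Set.mem_singleton_iff.1 ht, h.1, h.1]; exact logcosh_lip x y
      intro x y
      rw [h.2 s ⟨hs.1, h1⟩, h.2 s ⟨hs.1, h1⟩]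
      exact gStep_lip β Φ _ _ s ENNReal.toReal_nonneg ht x y

lemma local_const {μ : Measure ℝ} {S : Finset ℝ} (hS : μ ((S : Set ℝ))ᶜ = 0)
    {s : ℝ} (hsna : μ {s} = 0) :
    ∀ᶠ r in nhds s, nextPt μ r = nextPt μ s ∧ distF μ r = distF μ s := by
  have hev : ∀ᶠ r in nhds s, ∀ q ∈ S, q ≠ s → (r < q ↔ s < q) := by
    rw [Filter.eventually_all_finset]
    intro q _
    rcases lt_trichotomy q s with h | h | h
    · filter_upwards [lt_mem_nhds h] with r hr _
      exact ⟨fun h' => absurd hr h'.not_gt, fun h' => absurd h h'.not_gt⟩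
    · exact Eventually.of_forall fun r h' => absurd h h'
    · filter_upwards [gt_mem_nhds h] with r hr _
      exact ⟨fun _ => h, fun _ => hr⟩
  filter_upwards [hev] with r hr
  constructor
  · unfold nextPt
    congr 2
    ext q
    simp only [Set.mem_ofPred_eq]
    have : μ {q} ≠ 0 → (r < q ↔ s < q) := fun hq =>
      hr q (atoms_mem hS hq) (by rintro rfl; exact hq hsna)
    tauto
  · unfold distF
    congr 1
    refine measure_congr ?_
    have h1 : ∀ᵐ y ∂μ, y ∈ (S : Set ℝ) := by rw [ae_iff]; exact hS
    have h2 : ∀ᵐ y ∂μ, y ≠ s := by rw [ae_iff]; simpa using hsna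
    filter_upwards [h1, h2] with y hy1 hy2
    have := hr y hy1 hy2
    refine propext (and_congr_right fun _ => ?_)
    rw [← not_lt, ← not_lt, this]

lemma key_pde {β : ℕ → ℝ} {f : ℝ → ℝ} (hf : ∀ x y, f x ≤ f y + |x - y|) {m : ℝ} (hm : 0 ≤ m)
    (w : ℝ → ℝ) (s z : ℝ) (hw : HasDerivAt w (-z) s) (hw0 : 0 < w s) (U : ℝ → ℝ → ℝ)
    (hU : ∀ᶠ r in nhds s, ∀ x, U r x = if m = 0 then ∫ z, f (x + z * √(w r)) ∂(gaussianReal 0 1)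
      else m⁻¹ * Real.log (∫ z, Real.exp (m * f (x + z * √(w r))) ∂(gaussianReal 0 1))) (x : ℝ) :
    HasDerivAt (fun r => U r x)
      (-(z / 2) * (iteratedDeriv 2 (U s) x + m * (deriv (U s) x) ^ 2)) s := by
  have hc := lip_cont hf
  have hwpos : ∀ᶠ r in nhds s, 0 < w r := hw.continuousAt.eventually (lt_mem_nhds hw0)
  have hgr : ∀ y, |f y| ≤ |f 0| + |y| := by
    intro y
    have h1 := hf y 0
    have h2 := hf 0 y
    rw [sub_zero] at h1
    rw [zero_sub, abs_neg] at h2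
    rw [abs_le]
    have h4 := le_abs_self (f 0)
    have h5 := neg_abs_le (f 0)
    constructor <;> linarith
  rw [iteratedDeriv_succ, iteratedDeriv_one]
  rcases eq_or_lt_of_le hm with h0 | hmp
  · subst h0
    simp only [if_true] at hU
    have hb : ∀ y, |f y| ≤ (|f 0| + 1) * Real.exp (1 * |y|) := by
      intro y
      have := Real.add_one_le_exp |y|
      rw [one_mul]
      nlinarith [hgr y, abs_nonneg (f 0), abs_nonneg y]
    have H := fun v x hv => heat_main f hc _ 1 zero_le_one hb v x hv
    have hU' : ∀ᶠ r in nhds s, ∀ x, U r x = ∫ y, f y * heatK (w r) x y := by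
      filter_upwards [hU, hwpos] with r h1 h2 x
      rw [h1, gauss_eq_heat f hc _ _ h2]
    have hUs : U s = fun x => ∫ y, f y * heatK (w s) x y := funext hU'.self_of_nhds
    have hd1 : deriv (U s) = fun x => ∫ y, f y * (heatK (w s) x y * ((y - x) / w s)) := by
      rw [hUs]; ext x'; exact (H _ x' hw0).1.deriv
    rw [hd1, (H _ x hw0).2.1.deriv]
    have := ((H _ x hw0).2.2.comp s hw).congr_of_eventuallyEq
      (f₁ := fun r => U r x) (hU'.mono fun r hr => hr x)
    convert! this using 1
    ring
  · have hm0 : m ≠ 0 := hmp.ne'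
    simp only [if_neg hm0] at hU
    set F : ℝ → ℝ := fun y => Real.exp (m * f y) with hFdef
    have hFc : Continuous F := by fun_prop
    have hb : ∀ y, |F y| ≤ Real.exp (m * |f 0|) * Real.exp (m * |y|) := by
      intro y
      rw [abs_of_pos (Real.exp_pos _), ← Real.exp_add, ← mul_add]
      refine Real.exp_le_exp.2 (mul_le_mul_of_nonneg_left ?_ hm)
      exact (le_abs_self _).trans (hgr y)
    have H := fun v x hv => heat_main F hFc _ m hm hb v x hv
    have hU' : ∀ᶠ r in nhds s, ∀ x, U r x = m⁻¹ * Real.log (∫ y, F y * heatK (w r) x y) := by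
      filter_upwards [hU, hwpos] with r h1 h2 x
      rw [h1, ← gauss_eq_heat F hFc _ _ h2]
    have hpos : ∀ x, 0 < ∫ y, F y * heatK (w s) x y := by
      intro x
      rw [← gauss_eq_heat F hFc _ _ hw0]
      exact integral_exp_pos (lip_exp_int hf m hm _ x)
    have hUs : U s = fun x => m⁻¹ * Real.log (∫ y, F y * heatK (w s) x y) :=
      funext hU'.self_of_nhds
    have hd1 : deriv (U s) = fun x => m⁻¹ * ((∫ y, F y * (heatK (w s) x y * ((y - x) / w s))) /
        ∫ y, F y * heatK (w s) x y) := by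
      rw [hUs]; ext x'
      exact (((H _ x' hw0).1.log (hpos x').ne').const_mul m⁻¹).deriv
    have hd2 := ((((H _ x hw0).2.1).div (H _ x hw0).1 (hpos x).ne').const_mul m⁻¹).deriv
    have hd2' := (congrArg (fun g => deriv g x) hd1).trans hd2
    rw [hd2', hd1]
    have hcomp := (H _ x hw0).2.2.comp s hw
    have := ((hcomp.log (hpos x).ne').const_mul m⁻¹).congr_of_eventuallyEq
      (f₁ := fun r => U r x) (hU'.mono fun r hr => hr x)
    convert! this using 1
    have hne := (hpos x).ne'
    simp only [Function.comp_apply]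
    field_simp
    ring

/-- **The Parisi PDE on the strips.** For finitely supported `μ ∈ 𝓜_d`, at every
`s` inside one of the open strips `(q_l, q_{l+1})` (i.e. `s ∈ (0,1)` not an atom
of `μ`), `∂ₛ Φ_μ` exists and
`∂ₛΦ_μ(s,x) = -(ζ(s)/2)(∂ₓₓΦ_μ(s,x) + μ([0,s]) (∂ₓΦ_μ(s,x))²)`,
where `μ([0,s]) = m_l` on the strip. -/
theorem stmt13 (β : ℕ → ℝ) (hβ : ValidBeta β)
    (Φ : Measure ℝ → ℝ → ℝ → ℝ) (hΦ : IsParisiFamily β Φ)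
    (μ : Measure ℝ) (hμ : MemM μ) (hfs : FinSupp μ)
    (s : ℝ) (hs : s ∈ Ioo (0 : ℝ) 1) (hsna : μ {s} = 0) (x : ℝ) :
    HasDerivAt (fun r => Φ μ r x)
      (-(zetaFn β s / 2) *
        (iteratedDeriv 2 (Φ μ s) x + distF μ s * (deriv (Φ μ s) x) ^ 2)) s := by
  have hsol := hΦ.1 μ hμ hfs
  obtain ⟨S, hS⟩ := hfs
  have ht := nextPt_mem hS s
  have hst : s < nextPt μ s ∧ nextPt μ s ≤ 1 := by
    rcases ht with h | h
    · exact ⟨h.1, h.2.1⟩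
    · rw [Set.mem_singleton_iff.1 h]; exact ⟨hs.2, le_rfl⟩
  have hlip := sol_lip hsol hS _ (nextPt μ s) ⟨(hs.1.trans hst.1).le, hst.2⟩ rfl
  refine key_pde (β := β) hlip (m := distF μ s) ENNReal.toReal_nonneg
    (fun r => xiD β (nextPt μ s) - xiD β r) s (zetaFn β s) ((xiD_deriv hβ hs).const_sub _)
    (sub_pos.2 (xiD_lt hβ hs.1.le hst.1 hst.2)) (Φ μ) ?_ x
  filter_upwards [local_const hS hsna, Ioo_mem_nhds hs.1 hs.2] with r hr hr' x
  rw [hsol.2 r ⟨hr'.1.le, hr'.2⟩, hr.1, hr.2]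
  rfl

end
end

section
/- Let μ ∈ 𝓜 with distribution function α, let 0 < s < t ≤ 1 with α(s) > 0 and ∫_s^t α(r)ζ(r) dr < 1, and let x ∈ ℝ. Then F^{s,t}(·, x) is strictly concave on 𝓓[s,t]: for any u₀, u₁ ∈ 𝓓[s,t] with ‖u₀ − u₁‖ > 0 and any λ ∈ (0,1), writing u_λ = (1−λ)u₀ + λu₁, one has F^{s,t}(u_λ, x) > (1−λ) F^{s,t}(u₀, x) + λ F^{s,t}(u₁, x). -/
open MeasureTheory ProbabilityTheory Real Set Filter

noncomputable section

/-- the class of functions preserved by the backward recursion -/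
def GoodFn (g : ℝ → ℝ) : Prop :=
  (∀ x y, g x ≤ g y + |x - y|) ∧
  ∀ x d, Real.exp (g (x + d)) + Real.exp (g (x - d)) ≤ 2 * Real.cosh d * Real.exp (g x)

lemma GoodFn.continuous {g : ℝ → ℝ} (h : GoodFn g) : Continuous g := by
  have : LipschitzWith 1 g := LipschitzWith.of_le_add fun x y => by
    simpa [Real.dist_eq] using h.1 x y
  exact this.continuous

lemma goodFn_logcosh : GoodFn (fun x => Real.log (Real.cosh x)) := by
  constructor
  · intro x y
    have hx := Real.cosh_pos x
    have hy := Real.cosh_pos y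
    rw [← Real.log_exp |x - y|, ← Real.log_mul hy.ne' (Real.exp_pos _).ne']
    apply Real.log_le_log hx
    rw [Real.cosh_eq, Real.cosh_eq]
    have e1 : Real.exp x ≤ Real.exp y * Real.exp |x - y| := by
      rw [← Real.exp_add]; apply Real.exp_le_exp.2; linarith [le_abs_self (x - y)]
    have e2 : Real.exp (-x) ≤ Real.exp (-y) * Real.exp |x - y| := by
      rw [← Real.exp_add]; apply Real.exp_le_exp.2; linarith [neg_abs_le (x - y)]
    linarith
  · intro x d
    simp only [Real.exp_log (Real.cosh_pos _)]
    rw [Real.cosh_add, Real.cosh_sub]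
    linarith

lemma GoodFn.integrable_exp {g : ℝ → ℝ} (h : GoodFn g) {m : ℝ} (hm : 0 ≤ m) (x σ : ℝ) :
    Integrable (fun z => Real.exp (m * g (x + z * σ))) (gaussianReal 0 1) := by
  have h1 : Integrable (fun z : ℝ => Real.exp (m * |σ| * |z|)) (gaussianReal 0 1) :=
    integrable_exp_mul_abs (integrable_exp_mul_gaussianReal _) (integrable_exp_mul_gaussianReal _)
  have hc := h.continuous
  refine (h1.const_mul (Real.exp (m * g x))).mono' ?_ ?_
  · exact (by fun_prop : Continuous fun z => Real.exp (m * g (x + z * σ))).aestronglyMeasurable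
  · refine Eventually.of_forall fun z => ?_
    rw [Real.norm_eq_abs, abs_of_pos (Real.exp_pos _), ← Real.exp_add]
    apply Real.exp_le_exp.2
    have := h.1 (x + z * σ) x
    rw [add_sub_cancel_left, abs_mul] at this
    nlinarith

lemma GoodFn.integrable {g : ℝ → ℝ} (h : GoodFn g) (x σ : ℝ) :
    Integrable (fun z => g (x + z * σ)) (gaussianReal 0 1) := by
  have h1 : Integrable (fun z : ℝ => z) (gaussianReal 0 1) := by
    have := (memLp_id_gaussianReal (μ := 0) (v := 1) 1)
    exact this.integrable (by simp)
  have hc := h.continuous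
  refine ((integrable_const |g x|).add (h1.abs.mul_const |σ|)).mono' ?_ ?_
  · exact (by fun_prop : Continuous fun z => g (x + z * σ)).aestronglyMeasurable
  · refine Eventually.of_forall fun z => ?_
    have h2 := h.1 (x + z * σ) x
    have h3 := h.1 x (x + z * σ)
    rw [add_sub_cancel_left, abs_mul] at h2
    rw [abs_sub_comm, add_sub_cancel_left, abs_mul] at h3
    rw [Real.norm_eq_abs, abs_le]
    simp only [Pi.add_apply]
    constructor
    · linarith [neg_abs_le (g x)]
    · linarith [le_abs_self (g x)]

lemma goodFn_step0 {g : ℝ → ℝ} (h : GoodFn g) (σ : ℝ) :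
    GoodFn (fun x => ∫ z, g (x + z * σ) ∂(gaussianReal 0 1)) := by
  have hi := fun x => h.integrable x σ
  constructor
  · intro x y
    have : ∫ z, g (x + z * σ) ∂(gaussianReal 0 1)
        ≤ ∫ z, (g (y + z * σ) + |x - y|) ∂(gaussianReal 0 1) := by
      apply integral_mono (hi x) ((hi y).add (integrable_const _))
      intro z
      simpa using h.1 (x + z * σ) (y + z * σ)
    rwa [integral_add (hi y) (integrable_const _), integral_const, probReal_univ, one_smul] at this
  · intro x d
    set P := ∫ z, g (x + d + z * σ) ∂(gaussianReal 0 1) with hP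
    set Q := ∫ z, g (x - d + z * σ) ∂(gaussianReal 0 1) with hQ
    set F := ∫ z, g (x + z * σ) ∂(gaussianReal 0 1) with hF
    set L := Real.exp P + Real.exp Q with hL
    have hLp : 0 < L := by positivity
    have hcd := Real.cosh_pos d
    have hkey : ∀ z, Real.exp P / L * (g (x + d + z * σ) - P + Real.log L)
        + Real.exp Q / L * (g (x - d + z * σ) - Q + Real.log L)
        ≤ Real.log (2 * Real.cosh d) + g (x + z * σ) := by
      intro z
      have h2 := h.2 (x + z * σ) d
      rw [show x + z * σ + d = x + d + z * σ by ring,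
        show x + z * σ - d = x - d + z * σ by ring] at h2
      have hconv := convexOn_exp.2 (mem_univ (g (x + d + z * σ) - P + Real.log L))
        (mem_univ (g (x - d + z * σ) - Q + Real.log L))
        (show 0 ≤ Real.exp P / L by positivity) (show 0 ≤ Real.exp Q / L by positivity)
        (by rw [← add_div, ← hL, div_self hLp.ne'])
      simp only [smul_eq_mul] at hconv
      have e1 : Real.exp P / L * Real.exp (g (x + d + z * σ) - P + Real.log L)
          = Real.exp (g (x + d + z * σ)) := by
        rw [Real.exp_add, Real.exp_sub, Real.exp_log hLp]
        field_simp
      have e2 : Real.exp Q / L * Real.exp (g (x - d + z * σ) - Q + Real.log L)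
          = Real.exp (g (x - d + z * σ)) := by
        rw [Real.exp_add, Real.exp_sub, Real.exp_log hLp]
        field_simp
      rw [e1, e2] at hconv
      rw [← Real.exp_le_exp]
      refine (hconv.trans h2).trans ?_
      rw [Real.exp_add, Real.exp_log (by positivity)]
    have j1 : ∀ y c : ℝ, Integrable (fun z => g (y + z * σ) - c) (gaussianReal 0 1) :=
      fun y c => (hi y).sub (integrable_const c)
    have j2 : ∀ y c e : ℝ, Integrable (fun z => g (y + z * σ) - c + e) (gaussianReal 0 1) :=
      fun y c e => (j1 y c).add (integrable_const e)
    have hint := integral_mono (μ := gaussianReal 0 1)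
      (((j2 (x + d) P (Real.log L)).const_mul (Real.exp P / L)).add
      ((j2 (x - d) Q (Real.log L)).const_mul (Real.exp Q / L)))
      ((integrable_const (Real.log (2 * Real.cosh d))).add (hi x)) hkey
    have i1 : ∫ z, (g (x + d + z * σ) - P + Real.log L) ∂(gaussianReal 0 1) = Real.log L := by
      rw [integral_add (j1 _ _) (integrable_const _),
        integral_sub (hi (x + d)) (integrable_const _)]
      simp [← hP]
    have i2 : ∫ z, (g (x - d + z * σ) - Q + Real.log L) ∂(gaussianReal 0 1) = Real.log L := by
      rw [integral_add (j1 _ _) (integrable_const _),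
        integral_sub (hi (x - d)) (integrable_const _)]
      simp [← hQ]
    simp only [Pi.add_apply] at hint
    rw [integral_add ((j2 _ _ _).const_mul _) ((j2 _ _ _).const_mul _),
      integral_const_mul, integral_const_mul] at hint
    rw [i1, i2, integral_add (integrable_const _) (hi x), integral_const, probReal_univ, one_smul,
      ← hF, ← add_mul, ← add_div, ← hL, div_self hLp.ne', one_mul, ← Real.exp_le_exp,
      Real.exp_log hLp, Real.exp_add, Real.exp_log (by positivity)] at hint
    exact hint

lemma goodFn_step1 {g : ℝ → ℝ} (h : GoodFn g) (σ : ℝ) {m : ℝ} (hm : 0 < m) (hm1 : m ≤ 1) :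
    GoodFn (fun x => m⁻¹ * Real.log (∫ z, Real.exp (m * g (x + z * σ)) ∂(gaussianReal 0 1))) := by
  have hi := fun x => h.integrable_exp hm.le x σ
  have hpos : ∀ x, 0 < ∫ z, Real.exp (m * g (x + z * σ)) ∂(gaussianReal 0 1) := fun x =>
    integral_exp_pos (hi x)
  have hexp : ∀ x, Real.exp (m * (m⁻¹ * Real.log
      (∫ z, Real.exp (m * g (x + z * σ)) ∂(gaussianReal 0 1))))
      = ∫ z, Real.exp (m * g (x + z * σ)) ∂(gaussianReal 0 1) := fun x => by
    rw [mul_inv_cancel_left₀ hm.ne', Real.exp_log (hpos x)]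
  constructor
  · intro x y
    have h1 : ∫ z, Real.exp (m * g (x + z * σ)) ∂(gaussianReal 0 1)
        ≤ ∫ z, Real.exp (m * |x - y|) * Real.exp (m * g (y + z * σ)) ∂(gaussianReal 0 1) := by
      apply integral_mono (hi x) ((hi y).const_mul _)
      intro z
      have := h.1 (x + z * σ) (y + z * σ)
      rw [add_sub_add_right_eq_sub] at this
      simp only
      rw [← Real.exp_add]
      apply Real.exp_le_exp.2
      nlinarith
    rw [integral_const_mul, ← hexp x, ← hexp y, ← Real.exp_add, Real.exp_le_exp] at h1
    have := le_of_mul_le_mul_left (h1.trans_eq (by ring :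
      _ = m * (m⁻¹ * Real.log (∫ z, Real.exp (m * g (y + z * σ)) ∂(gaussianReal 0 1))
        + |x - y|))) hm
    exact this
  · intro x d
    have hA := hexp (x + d)
    have hB := hexp (x - d)
    have hF := hexp x
    simp only
    set P := m⁻¹ * Real.log (∫ z, Real.exp (m * g (x + d + z * σ)) ∂(gaussianReal 0 1))
    set Q := m⁻¹ * Real.log (∫ z, Real.exp (m * g (x - d + z * σ)) ∂(gaussianReal 0 1))
    set F := m⁻¹ * Real.log (∫ z, Real.exp (m * g (x + z * σ)) ∂(gaussianReal 0 1))
    set L := Real.exp P + Real.exp Q with hL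
    have hLp : 0 < L := by positivity
    have hcd := Real.cosh_pos d
    have hkey : ∀ z, Real.exp P / L * (Real.exp (m * (Real.log L - P))
          * Real.exp (m * g (x + d + z * σ)))
        + Real.exp Q / L * (Real.exp (m * (Real.log L - Q))
          * Real.exp (m * g (x - d + z * σ)))
        ≤ Real.exp (m * Real.log (2 * Real.cosh d)) * Real.exp (m * g (x + z * σ)) := by
      intro z
      have h2 := h.2 (x + z * σ) d
      rw [show x + z * σ + d = x + d + z * σ by ring,
        show x + z * σ - d = x - d + z * σ by ring] at h2
      have hconv := (Real.concaveOn_rpow hm.le hm1).2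
        (mem_Ici.2 (Real.exp_pos (g (x + d + z * σ) - P + Real.log L)).le)
        (mem_Ici.2 (Real.exp_pos (g (x - d + z * σ) - Q + Real.log L)).le)
        (show 0 ≤ Real.exp P / L by positivity) (show 0 ≤ Real.exp Q / L by positivity)
        (by rw [← add_div, ← hL, div_self hLp.ne'])
      simp only [smul_eq_mul] at hconv
      have e1 : Real.exp P / L * Real.exp (g (x + d + z * σ) - P + Real.log L)
          = Real.exp (g (x + d + z * σ)) := by
        rw [Real.exp_add, Real.exp_sub, Real.exp_log hLp]
        field_simp
      have e2 : Real.exp Q / L * Real.exp (g (x - d + z * σ) - Q + Real.log L)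
          = Real.exp (g (x - d + z * σ)) := by
        rw [Real.exp_add, Real.exp_sub, Real.exp_log hLp]
        field_simp
      rw [e1, e2, ← Real.exp_mul, ← Real.exp_mul] at hconv
      rw [← Real.exp_add, ← Real.exp_add, ← Real.exp_add]
      refine le_trans (le_of_eq ?_) (hconv.trans ((Real.rpow_le_rpow (by positivity) h2 hm.le).trans
        (le_of_eq ?_)))
      · congr 3 <;> ring
      · rw [show 2 * Real.cosh d * Real.exp (g (x + z * σ))
          = Real.exp (Real.log (2 * Real.cosh d) + g (x + z * σ)) by
            rw [Real.exp_add, Real.exp_log (by positivity)], ← Real.exp_mul]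
        congr 1; ring
    have hint := integral_mono (μ := gaussianReal 0 1)
      ((((hi (x + d)).const_mul (Real.exp (m * (Real.log L - P)))).const_mul (Real.exp P / L)).add
       (((hi (x - d)).const_mul (Real.exp (m * (Real.log L - Q)))).const_mul (Real.exp Q / L)))
      ((hi x).const_mul (Real.exp (m * Real.log (2 * Real.cosh d)))) hkey
    simp only [Pi.add_apply] at hint
    rw [integral_add
      (((hi (x + d)).const_mul (Real.exp (m * (Real.log L - P)))).const_mul (Real.exp P / L))
      (((hi (x - d)).const_mul (Real.exp (m * (Real.log L - Q)))).const_mul (Real.exp Q / L)),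
      integral_const_mul, integral_const_mul, integral_const_mul, integral_const_mul,
      integral_const_mul, ← hA, ← hB, ← hF, ← Real.exp_add, ← Real.exp_add, ← Real.exp_add,
      show m * (Real.log L - P) + m * P = m * Real.log L by ring,
      show m * (Real.log L - Q) + m * Q = m * Real.log L by ring,
      ← add_mul, ← add_div, ← hL, div_self hLp.ne', one_mul, Real.exp_le_exp, ← mul_add] at hint
    have := le_of_mul_le_mul_left hint hm
    rw [← Real.exp_le_exp, Real.exp_log hLp, Real.exp_add, Real.exp_log (by positivity)] at this
    exact this

lemma distF_mono (μ : Measure ℝ) [IsProbabilityMeasure μ] : Monotone (distF μ) := by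
  intro a b hab
  exact ENNReal.toReal_mono (measure_ne_top _ _) (measure_mono (Icc_subset_Icc_right hab))

lemma distF_nonneg (μ : Measure ℝ) (a : ℝ) : 0 ≤ distF μ a := ENNReal.toReal_nonneg

lemma distF_le_one (μ : Measure ℝ) [IsProbabilityMeasure μ] (a : ℝ) : distF μ a ≤ 1 := by
  exact measureReal_le_one

lemma goodFn_gStep {β : ℕ → ℝ} {Φ : ℝ → ℝ → ℝ} {m t s : ℝ} (h : GoodFn (Φ t)) (hm : 0 ≤ m)
    (hm1 : m ≤ 1) : GoodFn (fun x => gStep β Φ m t s x) := by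
  unfold gStep
  by_cases h0 : m = 0
  · simp only [h0, if_true]
    exact goodFn_step0 h _
  · simp only [h0, if_false]
    exact goodFn_step1 h _ (lt_of_le_of_ne hm (Ne.symm h0)) hm1

lemma goodFn_atomic {β : ℕ → ℝ} {μ : Measure ℝ} (hμ : MemM μ) (hf : FinSupp μ) {Φ : ℝ → ℝ → ℝ}
    (hΦ : IsAtomicSol β μ Φ) : ∀ s ∈ Icc (0 : ℝ) 1, GoodFn (Φ s) := by
  have := hμ.1
  obtain ⟨S, hS⟩ := hf
  have h1 : GoodFn (Φ 1) := by
    rw [show Φ 1 = fun x => Real.log (Real.cosh x) from funext hΦ.1]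
    exact goodFn_logcosh
  have key : ∀ n : ℕ, ∀ s ∈ Icc (0 : ℝ) 1, (S.filter (fun q => s < q)).card ≤ n →
      GoodFn (Φ s) := by
    intro n
    induction n with
    | zero =>
      intro s hs hc
      rcases hs.2.eq_or_lt with rfl | hs1
      · exact h1
      rw [show Φ s = fun x => gStep β Φ (distF μ s) (nextPt μ s) s x from
        funext (hΦ.2 s ⟨hs.1, hs1⟩)]
      have hemp : S.filter (fun q => s < q) = ∅ := Finset.card_eq_zero.1 (by omega)
      have : nextPt μ s = 1 := by
        unfold nextPt
        have : {q : ℝ | s < q ∧ q ≤ 1 ∧ μ {q} ≠ 0} = ∅ := by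
          ext q
          simp only [mem_ofPred_eq, mem_empty_iff_false, iff_false]
          rintro ⟨a, -, c⟩
          apply c
          refine measure_mono_null ?_ hS
          rintro y rfl hy
          have : y ∈ S.filter (fun q => s < q) := by simp [a]; exact hy
          simp [hemp] at this
        simp [this]
      rw [this]
      exact goodFn_gStep h1 (distF_nonneg _ _) (distF_le_one _ _)
    | succ n ih =>
      intro s hs hc
      rcases hs.2.eq_or_lt with rfl | hs1
      · exact h1
      rw [show Φ s = fun x => gStep β Φ (distF μ s) (nextPt μ s) s x from
        funext (hΦ.2 s ⟨hs.1, hs1⟩)]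
      apply goodFn_gStep _ (distF_nonneg _ _) (distF_le_one _ _)
      have hsub : {q : ℝ | s < q ∧ q ≤ 1 ∧ μ {q} ≠ 0} ⊆ (S : Set ℝ) := by
        rintro q ⟨a, -, c⟩
        by_contra hq
        apply c
        refine measure_mono_null ?_ hS
        rintro y rfl
        exact hq
      have hfin : ({q : ℝ | s < q ∧ q ≤ 1 ∧ μ {q} ≠ 0} ∪ {1}).Finite :=
        (S.finite_toSet.subset hsub).union (finite_singleton 1)
      have hmem : nextPt μ s ∈ ({q : ℝ | s < q ∧ q ≤ 1 ∧ μ {q} ≠ 0} ∪ {1}) :=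
        Set.Nonempty.csInf_mem ⟨1, Or.inr rfl⟩ hfin
      rcases hmem with hmem | hmem
      · refine ih _ ⟨hs.1.trans hmem.1.le, hmem.2.1⟩ ?_
        have : (S.filter (fun q => nextPt μ s < q)).card < (S.filter (fun q => s < q)).card := by
          apply Finset.card_lt_card
          rw [Finset.ssubset_iff_of_subset]
          · refine ⟨nextPt μ s, ?_, by simp⟩
            rw [Finset.mem_filter]
            exact ⟨by exact_mod_cast hsub hmem, hmem.1⟩
          · intro q hq
            rw [Finset.mem_filter] at hq ⊢
            exact ⟨hq.1, hmem.1.trans hq.2⟩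
        omega
      · rw [mem_singleton_iff] at hmem
        rw [hmem]; exact h1
  intro s hs
  exact key _ s hs le_rfl

lemma exists_atomic_approx (μ : Measure ℝ) (hμ : MemM μ) (δ : ℝ) (hδ : 0 < δ) :
    ∃ ν, MemM ν ∧ FinSupp ν ∧ dM μ ν < δ := by
  have := hμ.1
  obtain ⟨n, hn⟩ := exists_nat_one_div_lt hδ
  set N : ℝ := (n : ℝ) + 1 with hN
  have hNp : 0 < N := by positivity
  set f : ℝ → ℝ := fun q => (⌈q * N⌉ : ℝ) / N with hf
  have hfm : Measurable f := by
    have : Measurable (fun q : ℝ => ⌈q * N⌉) := Int.measurable_ceil.comp (measurable_id.mul_const N)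
    exact (measurable_from_top.comp this : Measurable fun q : ℝ => ((⌈q * N⌉ : ℤ) : ℝ)).div_const N
  have hf1 : ∀ q, q ≤ f q := fun q => by
    rw [hf]; simp only; rw [le_div_iff₀ hNp]; exact Int.le_ceil _
  have hf2 : ∀ q, f q ≤ q + 1 / N := fun q => by
    rw [hf]; simp only; rw [div_le_iff₀ hNp, add_mul, one_div_mul_cancel hNp.ne']
    exact (Int.ceil_lt_add_one _).le
  have hp : IsProbabilityMeasure (μ.map f) := Measure.isProbabilityMeasure_map hfm.aemeasurable
  have hS : (μ.map f) ((((Finset.range (n + 2)).image (fun i : ℕ => (i : ℝ) / N) : Finset ℝ)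
      : Set ℝ))ᶜ = 0 := by
    rw [Measure.map_apply hfm (Finset.measurableSet _).compl]
    refine measure_mono_null ?_ hμ.2
    intro q hq hq1
    apply hq
    simp only [Finset.coe_image, mem_image, Finset.coe_range, mem_Iio]
    have h0 : 0 ≤ ⌈q * N⌉ := Int.ceil_nonneg (mul_nonneg hq1.1 hNp.le)
    have h1 : ⌈q * N⌉ ≤ (n : ℤ) + 1 := by
      rw [Int.ceil_le]; push_cast; rw [← hN]
      nlinarith [hq1.2]
    refine ⟨⌈q * N⌉.toNat, by omega, ?_⟩
    rw [hf]
    simp only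
    congr 1
    exact_mod_cast Int.toNat_of_nonneg h0
  refine ⟨μ.map f, ⟨hp, ?_⟩, ⟨_, hS⟩, ?_⟩
  · refine measure_mono_null ?_ hS
    intro q hq hq1
    apply hq
    simp only [Finset.coe_image, mem_image, Finset.coe_range, mem_Iio] at hq1
    obtain ⟨i, hi, rfl⟩ := hq1
    refine ⟨by positivity, ?_⟩
    rw [div_le_one hNp, hN]
    exact_mod_cast Nat.lt_succ_iff.1 hi
  · have hle : ∀ r, distF (μ.map f) r ≤ distF μ r := by
      intro r
      unfold distF
      apply ENNReal.toReal_mono (measure_ne_top _ _)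
      rw [Measure.map_apply hfm measurableSet_Icc]
      calc μ (f ⁻¹' Icc 0 r) ≤ μ (Icc 0 r ∪ (Icc 0 1)ᶜ) := by
            apply measure_mono
            intro q hq
            by_cases h : q ∈ Icc (0 : ℝ) 1
            · exact Or.inl ⟨h.1, (hf1 q).trans hq.2⟩
            · exact Or.inr h
        _ ≤ μ (Icc 0 r) + μ (Icc 0 1)ᶜ := measure_union_le _ _
        _ = μ (Icc 0 r) := by rw [hμ.2, add_zero]
    have hge : ∀ r, distF μ (r - 1 / N) ≤ distF (μ.map f) r := by
      intro r
      unfold distF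
      apply ENNReal.toReal_mono (measure_ne_top _ _)
      rw [Measure.map_apply hfm measurableSet_Icc]
      apply measure_mono
      intro q hq
      exact ⟨hq.1.trans (hf1 q), by linarith [hf2 q, hq.2]⟩
    have hm := distF_mono μ
    have hm' := distF_mono (μ.map f)
    have hii : ∀ a b, IntervalIntegrable (distF μ) volume a b := fun a b => hm.intervalIntegrable
    have hii2 : IntervalIntegrable (fun r => distF μ (r - 1 / N)) volume 0 1 :=
      (hm.comp (fun a b h => by linarith : Monotone fun r : ℝ => r - 1 / N)).intervalIntegrable
    calc dM μ (μ.map f) ≤ ∫ r in (0 : ℝ)..1, (distF μ r - distF μ (r - 1 / N)) := by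
          unfold dM
          apply intervalIntegral.integral_mono_on zero_le_one
          · exact ((hii 0 1).sub hm'.intervalIntegrable).abs
          · exact (hii 0 1).sub hii2
          · intro r _
            rw [abs_of_nonneg (by linarith [hle r])]
            linarith [hge r]
      _ = (∫ r in (1 - 1 / N)..1, distF μ r) - ∫ r in (0 - 1 / N)..0, distF μ r := by
          rw [intervalIntegral.integral_sub (hii 0 1) hii2,
            intervalIntegral.integral_comp_sub_right (fun r => distF μ r) (1 / N)]
          have e1 := intervalIntegral.integral_add_adjacent_intervals (hii (0 - 1 / N) 0) (hii 0 1)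
          have e2 := intervalIntegral.integral_add_adjacent_intervals (hii (0 - 1 / N) (1 - 1 / N))
            (hii (1 - 1 / N) 1)
          linarith
      _ ≤ (∫ r in (1 - 1 / N)..1, (1 : ℝ)) - 0 := by
          have : 0 < 1 / N := by positivity
          apply sub_le_sub
          · apply intervalIntegral.integral_mono_on (by linarith) (hii _ _) (by simp)
            intro r _
            exact distF_le_one _ _
          · apply intervalIntegral.integral_nonneg (by linarith)
            intro r _
            exact distF_nonneg _ _
      _ = 1 / N := by simp
      _ < δ := hn

lemma goodFn_parisi {β : ℕ → ℝ} {Φ : Measure ℝ → ℝ → ℝ → ℝ} (hΦ : IsParisiFamily β Φ)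
    {μ : Measure ℝ} (hμ : MemM μ) {t : ℝ} (ht : t ∈ Icc (0 : ℝ) 1) : GoodFn (Φ μ t) := by
  have hex : ∀ n : ℕ, ∃ g : ℝ → ℝ, GoodFn g ∧ ∀ x, |Φ μ t x - g x| < 1 / ((n : ℝ) + 1) := by
    intro n
    obtain ⟨δ, hδ, h⟩ := hΦ.2 μ hμ (1 / ((n : ℝ) + 1)) (by positivity)
    obtain ⟨ν, h1, h2, h3⟩ := exists_atomic_approx μ hμ δ hδ
    exact ⟨Φ ν t, goodFn_atomic h1 h2 (hΦ.1 ν h1 h2) t ht, h ν h1 h3 t ht⟩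
  choose g hg hgl using hex
  have hlim : ∀ x, Tendsto (fun n => g n x) atTop (nhds (Φ μ t x)) := by
    intro x
    rw [tendsto_iff_dist_tendsto_zero]
    refine squeeze_zero (fun _ => dist_nonneg) (fun n => ?_)
      (tendsto_one_div_add_atTop_nhds_zero_nat (𝕜 := ℝ))
    rw [dist_comm, Real.dist_eq]
    exact (hgl n x).le
  have hexp : ∀ x, Tendsto (fun n => Real.exp (g n x)) atTop (nhds (Real.exp (Φ μ t x))) :=
    fun x => (Real.continuous_exp.tendsto _).comp (hlim x)
  constructor
  · intro x y
    exact le_of_tendsto_of_tendsto' (hlim x) ((hlim y).add_const _) fun n => (hg n).1 x y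
  · intro x d
    exact le_of_tendsto_of_tendsto' ((hexp _).add (hexp _)) ((hexp _).const_mul _)
      fun n => (hg n).2 x d

lemma GoodFn.mid {g : ℝ → ℝ} (h : GoodFn g) (x d : ℝ) :
    (g (x + d) + g (x - d)) / 2 ≤ g x + d ^ 2 / 2 := by
  have h1 := h.2 x d
  have h2 := Real.cosh_le_exp_half_sq d
  have h3 : Real.exp ((g (x + d) + g (x - d)) / 2) ≤
      (Real.exp (g (x + d)) + Real.exp (g (x - d))) / 2 := by
    have := convexOn_exp.2 (mem_univ (g (x + d))) (mem_univ (g (x - d)))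
      (show (0 : ℝ) ≤ 1 / 2 by norm_num) (show (0 : ℝ) ≤ 1 / 2 by norm_num) (by norm_num)
    simp only [smul_eq_mul] at this
    rw [show (g (x + d) + g (x - d)) / 2 = 1 / 2 * g (x + d) + 1 / 2 * g (x - d) by ring]
    linarith
  rw [← Real.exp_le_exp, Real.exp_add]
  have h4 := mul_le_mul_of_nonneg_right h2 (Real.exp_pos (g x)).le
  linarith

/-- continuous midpoint-concave functions vanishing at endpoints are nonnegative -/
lemma nonneg_of_midpoint {φ : ℝ → ℝ} (hc : Continuous φ)
    (hm : ∀ x d, (φ (x + d) + φ (x - d)) / 2 ≤ φ x) (h0 : φ 0 = 0) (h1 : φ 1 = 0) :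
    ∀ l ∈ Icc (0 : ℝ) 1, 0 ≤ φ l := by
  by_contra! hcon
  obtain ⟨l, hl, hneg⟩ := hcon
  obtain ⟨p, hp, hpm⟩ := isCompact_Icc.exists_isMinOn (nonempty_Icc.2 (zero_le_one (α := ℝ)))
    hc.continuousOn
  have hpm : ∀ y ∈ Icc (0 : ℝ) 1, φ p ≤ φ y := fun y hy => hpm hy
  have hS : IsCompact (Icc (0 : ℝ) 1 ∩ φ ⁻¹' {φ p}) :=
    isCompact_Icc.inter_right (isClosed_singleton.preimage hc)
  obtain ⟨q, ⟨hq, hqe⟩, hqm⟩ := hS.exists_isLeast ⟨p, hp, rfl⟩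
  have hqe : φ q = φ p := hqe
  have hqn : φ q < 0 := by rw [hqe]; exact (hpm l hl).trans_lt hneg
  have hq0 : 0 < q := lt_of_le_of_ne hq.1 (by rintro rfl; linarith)
  have hq1 : q < 1 := lt_of_le_of_ne hq.2 (by rintro rfl; linarith)
  set d := min q (1 - q) with hd
  have hdp : 0 < d := lt_min hq0 (by linarith)
  have hd1 : d ≤ q := min_le_left _ _
  have hd2 : d ≤ 1 - q := min_le_right _ _
  have e1 := hpm (q + d) ⟨by linarith, by linarith⟩
  have e2 := hpm (q - d) ⟨by linarith, by linarith⟩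
  have e3 : φ (q - d) ≠ φ p := by
    intro he
    have : q ≤ q - d := hqm ⟨⟨by linarith, by linarith⟩, he⟩
    linarith
  have e4 : φ p < φ (q - d) := lt_of_le_of_ne e2 (Ne.symm e3)
  linarith [hm q d]

lemma GoodFn.conc {g : ℝ → ℝ} (h : GoodFn g) (a b l : ℝ) (hl : l ∈ Icc (0 : ℝ) 1) :
    (1 - l) * g a + l * g b ≤ g ((1 - l) * a + l * b) + l * (1 - l) * (a - b) ^ 2 / 2 := by
  have hc := h.continuous
  have := nonneg_of_midpoint (φ := fun l => g ((1 - l) * a + l * b)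
    + l * (1 - l) * (a - b) ^ 2 / 2 - ((1 - l) * g a + l * g b)) (by fun_prop) ?_ (by simp)
    (by simp) l hl
  · linarith
  · intro x d
    have := h.mid ((1 - x) * a + x * b) (d * (b - a))
    rw [show (1 - (x + d)) * a + (x + d) * b = (1 - x) * a + x * b + d * (b - a) by ring,
      show (1 - (x - d)) * a + (x - d) * b = (1 - x) * a + x * b - d * (b - a) by ring]
    nlinarith

section core
set_option linter.unusedSectionVars false
variable {Ω : Type*} [MeasurableSpace Ω]

/-- measurable processes bounded by one -/
def NiceP (w : ℝ → Ω → ℝ) : Prop :=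
  Measurable (Function.uncurry w) ∧ ∀ r ω, |w r ω| ≤ 1

lemma kw_meas {k : ℝ → ℝ} (hk : Measurable k) {w : ℝ → Ω → ℝ}
    (hw : Measurable (Function.uncurry w)) (s t : ℝ) :
    Measurable fun ω => ∫ r in s..t, k r * w r ω := by
  have h : Measurable (fun p : Ω × ℝ => k p.2 * w p.2 p.1) :=
    (hk.comp measurable_snd).mul (hw.comp measurable_swap)
  simp only [intervalIntegral]
  exact (h.stronglyMeasurable.integral_prod_right'.sub
    h.stronglyMeasurable.integral_prod_right').measurable

lemma kw_int {k : ℝ → ℝ} (hk : Measurable k) {C : ℝ} (hC : ∀ r, |k r| ≤ C) {w : ℝ → Ω → ℝ}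
    (hw : Measurable (Function.uncurry w)) {D : ℝ} (hD : ∀ r ω, |w r ω| ≤ D) (s t : ℝ) (ω : Ω) :
    IntervalIntegrable (fun r => k r * w r ω) volume s t := by
  have hm : Measurable (fun r => k r * w r ω) :=
    hk.mul (hw.comp (measurable_id.prodMk measurable_const))
  refine (intervalIntegrable_const (c := C * D)).mono_fun' hm.aestronglyMeasurable
    (Eventually.of_forall fun r => ?_)
  simp only [Real.norm_eq_abs, abs_mul]
  exact mul_le_mul (hC r) (hD r ω) (abs_nonneg _) ((abs_nonneg _).trans (hC r))

lemma kw_bound {k : ℝ → ℝ} {C : ℝ} (hC : ∀ r, |k r| ≤ C) {w : ℝ → Ω → ℝ}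
    {D : ℝ} (hD : ∀ r ω, |w r ω| ≤ D) (s t : ℝ) (ω : Ω) :
    |∫ r in s..t, k r * w r ω| ≤ C * D * |t - s| := by
  have := intervalIntegral.norm_integral_le_of_norm_le_const (a := s) (b := t) (C := C * D)
    (f := fun r => k r * w r ω) (fun r _ => by
      simp only [Real.norm_eq_abs, abs_mul]
      exact mul_le_mul (hC r) (hD r ω) (abs_nonneg _) ((abs_nonneg _).trans (hC r)))
  simpa using this

lemma kw_integrable (P : Measure Ω) [IsProbabilityMeasure P]
    {k : ℝ → ℝ} (hk : Measurable k) {C : ℝ} (hC : ∀ r, |k r| ≤ C) {w : ℝ → Ω → ℝ}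
    (hw : Measurable (Function.uncurry w)) {D : ℝ} (hD : ∀ r ω, |w r ω| ≤ D) (s t : ℝ) :
    Integrable (fun ω => ∫ r in s..t, k r * w r ω) P :=
  (integrable_const (C * D * |t - s|)).mono' (kw_meas hk hw s t).aestronglyMeasurable
    (Eventually.of_forall fun ω => kw_bound hC hD s t ω)

lemma NiceP.sq_meas {w : ℝ → Ω → ℝ} (hw : NiceP w) :
    Measurable (Function.uncurry fun r ω => (w r ω) ^ 2) := hw.1.pow_const 2

lemma NiceP.sq_bd {w : ℝ → Ω → ℝ} (hw : NiceP w) (r : ℝ) (ω : Ω) : |(w r ω) ^ 2| ≤ 1 := by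
  rw [abs_pow]; exact pow_le_one₀ (abs_nonneg _) (hw.2 r ω)

lemma F_integrable (P : Measure Ω) [IsProbabilityMeasure P]
    {k : ℝ → ℝ} (hk : Measurable k) {C : ℝ} (hC : ∀ r, |k r| ≤ C) {w : ℝ → Ω → ℝ}
    (hw : NiceP w) (s t x : ℝ) {g : ℝ → ℝ} (hg : GoodFn g) {G : Ω → ℝ} (hG : Measurable G)
    (hGi : Integrable G P) :
    Integrable (fun ω => g (x + (∫ r in s..t, k r * w r ω) + G ω)
      - (1 / 2) * ∫ r in s..t, k r * (w r ω) ^ 2) P := by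
  have hA := kw_integrable P hk hC hw.1 hw.2 s t
  have hAm := kw_meas hk hw.1 s t
  refine Integrable.sub ?_ ((kw_integrable P hk hC hw.sq_meas hw.sq_bd s t).const_mul _)
  have hgm := hg.continuous.measurable
  refine ((integrable_const |g x|).add (hA.abs.add hGi.abs)).mono'
    (hgm.comp ((hAm.const_add x).add hG)).aestronglyMeasurable (Eventually.of_forall fun ω => ?_)
  simp only [Pi.add_apply]
  set A := ∫ r in s..t, k r * w r ω
  have h2 := hg.1 (x + A + G ω) x
  have h3 := hg.1 x (x + A + G ω)
  rw [abs_sub_comm] at h3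
  have h4 : |x + A + G ω - x| ≤ |A| + |G ω| := by
    rw [show x + A + G ω - x = A + G ω by ring]; exact abs_add_le _ _
  rw [Real.norm_eq_abs, abs_le]
  constructor
  · linarith [neg_abs_le (g x)]
  · linarith [le_abs_self (g x)]

lemma core_ineq (P : Measure Ω) [IsProbabilityMeasure P]
    {k : ℝ → ℝ} (hk : Measurable k) {c C : ℝ} (hc : 0 < c) (hck : ∀ r, c ≤ k r)
    (hC : ∀ r, k r ≤ C) {s t : ℝ} (hst : s < t) (hK : ∫ r in s..t, k r < 1) (x : ℝ)
    {w₀ w₁ : ℝ → Ω → ℝ} (hw₀ : NiceP w₀) (hw₁ : NiceP w₁)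
    {g : ℝ → ℝ} (hg : GoodFn g) {G : Ω → ℝ} (hG : Measurable G) (hGi : Integrable G P)
    (hne : 0 < ∫ ω, (∫ r in s..t, (w₀ r ω - w₁ r ω) ^ 2) ∂P) {l : ℝ} (hl : l ∈ Ioo (0 : ℝ) 1) :
    (1 - l) * (∫ ω, (g (x + (∫ r in s..t, k r * w₀ r ω) + G ω)
      - (1 / 2) * ∫ r in s..t, k r * (w₀ r ω) ^ 2) ∂P)
    + l * (∫ ω, (g (x + (∫ r in s..t, k r * w₁ r ω) + G ω)
      - (1 / 2) * ∫ r in s..t, k r * (w₁ r ω) ^ 2) ∂P)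
    < ∫ ω, (g (x + (∫ r in s..t, k r * ((1 - l) * w₀ r ω + l * w₁ r ω)) + G ω)
      - (1 / 2) * ∫ r in s..t, k r * ((1 - l) * w₀ r ω + l * w₁ r ω) ^ 2) ∂P := by
  have hl0 := hl.1
  have hl1 : 0 < 1 - l := sub_pos.2 hl.2
  have hCa : ∀ r, |k r| ≤ C := fun r => by rw [abs_of_nonneg (hc.le.trans (hck r))]; exact hC r
  have hwl : NiceP (fun r ω => (1 - l) * w₀ r ω + l * w₁ r ω) := by
    refine ⟨(hw₀.1.const_mul (1 - l)).add (hw₁.1.const_mul l), fun r ω => ?_⟩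
    have h0 := abs_le.1 (hw₀.2 r ω)
    have h1 := abs_le.1 (hw₁.2 r ω)
    rw [abs_le]
    constructor <;> nlinarith
  have hdm : Measurable (Function.uncurry fun r ω => w₀ r ω - w₁ r ω) := hw₀.1.sub hw₁.1
  have hd2m : Measurable (Function.uncurry fun r ω => (w₀ r ω - w₁ r ω) ^ 2) := hdm.pow_const 2
  have hdb : ∀ r ω, |w₀ r ω - w₁ r ω| ≤ 2 := fun r ω => by
    refine (abs_sub _ _).trans ?_
    linarith [hw₀.2 r ω, hw₁.2 r ω]
  have hd2b : ∀ r ω, |(w₀ r ω - w₁ r ω) ^ 2| ≤ 4 := fun r ω => by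
    rw [abs_pow]; nlinarith [hdb r ω, abs_nonneg (w₀ r ω - w₁ r ω)]
  have I₀ := F_integrable P hk hCa hw₀ s t x hg hG hGi
  have I₁ := F_integrable P hk hCa hw₁ s t x hg hG hGi
  have Il := F_integrable P hk hCa hwl s t x hg hG hGi
  have hone : ∀ r : ℝ, |(fun _ => 1 : ℝ → ℝ) r| ≤ 1 := by simp
  have Id : Integrable (fun ω => ∫ r in s..t, (w₀ r ω - w₁ r ω) ^ 2) P := by
    have := kw_integrable P (k := fun _ => 1) measurable_const hone hd2m hd2b s t
    simpa using this
  set K := ∫ r in s..t, k r with hKdef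
  have hkint : IntervalIntegrable k volume s t := by
    refine (intervalIntegrable_const (c := C)).mono_fun' hk.aestronglyMeasurable
      (Eventually.of_forall fun r => ?_)
    exact hCa r
  have hKpos : 0 < K := by
    have h1 : ∫ r in s..t, c ≤ K :=
      intervalIntegral.integral_mono_on hst.le (by simp) hkint fun r _ => hck r
    have h2 : 0 < (t - s) * c := mul_pos (sub_pos.2 hst) hc
    simp at h1
    linarith
  have hpt : ∀ ω, (1 - l) * (g (x + (∫ r in s..t, k r * w₀ r ω) + G ω)
      - (1 / 2) * ∫ r in s..t, k r * (w₀ r ω) ^ 2)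
    + l * (g (x + (∫ r in s..t, k r * w₁ r ω) + G ω)
      - (1 / 2) * ∫ r in s..t, k r * (w₁ r ω) ^ 2)
    + l * (1 - l) / 2 * ((1 - K) * c) * (∫ r in s..t, (w₀ r ω - w₁ r ω) ^ 2)
    ≤ (g (x + (∫ r in s..t, k r * ((1 - l) * w₀ r ω + l * w₁ r ω)) + G ω)
      - (1 / 2) * ∫ r in s..t, k r * ((1 - l) * w₀ r ω + l * w₁ r ω) ^ 2) := by
    intro ω
    have i0 := kw_int hk hCa hw₀.1 hw₀.2 s t ω
    have i1 := kw_int hk hCa hw₁.1 hw₁.2 s t ω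
    have i0s := kw_int hk hCa hw₀.sq_meas hw₀.sq_bd s t ω
    have i1s := kw_int hk hCa hw₁.sq_meas hw₁.sq_bd s t ω
    have id1 := kw_int hk hCa hdm hdb s t ω
    have id2 := kw_int hk hCa hd2m hd2b s t ω
    have idd := kw_int (k := fun _ => 1) measurable_const hone hd2m hd2b s t ω
    set A₀ := ∫ r in s..t, k r * w₀ r ω with hA₀
    set A₁ := ∫ r in s..t, k r * w₁ r ω with hA₁
    set V₀ := ∫ r in s..t, k r * (w₀ r ω) ^ 2 with hV₀
    set V₁ := ∫ r in s..t, k r * (w₁ r ω) ^ 2 with hV₁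
    set E := ∫ r in s..t, (w₀ r ω - w₁ r ω) ^ 2 with hE
    set V := ∫ r in s..t, k r * (w₀ r ω - w₁ r ω) ^ 2 with hV
    have eA : ∫ r in s..t, k r * ((1 - l) * w₀ r ω + l * w₁ r ω) = (1 - l) * A₀ + l * A₁ := by
      rw [hA₀, hA₁, ← intervalIntegral.integral_const_mul, ← intervalIntegral.integral_const_mul,
        ← intervalIntegral.integral_add (i0.const_mul _) (i1.const_mul _)]
      congr 1; ext r; ring
    have eV : ∫ r in s..t, k r * ((1 - l) * w₀ r ω + l * w₁ r ω) ^ 2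
        = (1 - l) * V₀ + l * V₁ - l * (1 - l) * V := by
      rw [hV₀, hV₁, hV, ← intervalIntegral.integral_const_mul,
        ← intervalIntegral.integral_const_mul, ← intervalIntegral.integral_const_mul,
        ← intervalIntegral.integral_add (i0s.const_mul _) (i1s.const_mul _),
        ← intervalIntegral.integral_sub ((i0s.const_mul _).add (i1s.const_mul _))
          (id2.const_mul _)]
      congr 1; ext r; ring
    have eD : ∫ r in s..t, k r * (w₀ r ω - w₁ r ω) = A₀ - A₁ := by
      rw [hA₀, hA₁, ← intervalIntegral.integral_sub i0 i1]
      congr 1; ext r; ring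
    have hVE : c * E ≤ V := by
      rw [hE, hV, ← intervalIntegral.integral_const_mul]
      apply intervalIntegral.integral_mono_on hst.le (by simpa using idd.const_mul c) id2
      intro r _
      exact mul_le_mul_of_nonneg_right (hck r) (sq_nonneg _)
    have hCS : (A₀ - A₁) ^ 2 ≤ K * V := by
      set e := (A₀ - A₁) / K with he
      have hnn : 0 ≤ ∫ r in s..t, k r * (w₀ r ω - w₁ r ω - e) ^ 2 :=
        intervalIntegral.integral_nonneg hst.le fun r _ =>
          mul_nonneg (hc.le.trans (hck r)) (sq_nonneg _)
      have heq : ∫ r in s..t, k r * (w₀ r ω - w₁ r ω - e) ^ 2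
          = V - 2 * e * (A₀ - A₁) + e ^ 2 * K := by
        rw [← eD, hV, hKdef, ← intervalIntegral.integral_const_mul,
          ← intervalIntegral.integral_const_mul,
          ← intervalIntegral.integral_sub id2 (id1.const_mul _),
          ← intervalIntegral.integral_add (id2.sub (id1.const_mul _)) (hkint.const_mul _)]
        congr 1; ext r; ring
      rw [heq] at hnn
      have heK : e * K = A₀ - A₁ := div_mul_cancel₀ _ hKpos.ne'
      nlinarith [mul_nonneg hKpos.le hnn]
    have hconc := hg.conc (x + A₀ + G ω) (x + A₁ + G ω) l ⟨hl0.le, hl.2.le⟩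
    rw [show (1 - l) * (x + A₀ + G ω) + l * (x + A₁ + G ω)
      = x + ((1 - l) * A₀ + l * A₁) + G ω by ring,
      show x + A₀ + G ω - (x + A₁ + G ω) = A₀ - A₁ by ring] at hconc
    rw [eA, eV]
    have hll : 0 ≤ l * (1 - l) / 2 := by positivity
    have f1 : (1 - K) * (c * E) ≤ (1 - K) * V := mul_le_mul_of_nonneg_left hVE (by linarith)
    have f2 : (1 - K) * c * E ≤ V - (A₀ - A₁) ^ 2 := by linarith
    have f3 := mul_le_mul_of_nonneg_left f2 hll
    linarith
  have J01 := (I₀.const_mul (1 - l)).add (I₁.const_mul l)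
  have hint := integral_mono (J01.add (Id.const_mul (l * (1 - l) / 2 * ((1 - K) * c)))) Il hpt
  rw [integral_add' J01 (Id.const_mul (l * (1 - l) / 2 * ((1 - K) * c))),
    integral_add' (I₀.const_mul (1 - l)) (I₁.const_mul l), integral_const_mul, integral_const_mul,
    integral_const_mul] at hint
  have : 0 < l * (1 - l) / 2 * ((1 - K) * c)
      * ∫ ω, (∫ r in s..t, (w₀ r ω - w₁ r ω) ^ 2) ∂P := by
    have : 0 < 1 - K := sub_pos.2 hK
    positivity
  linarith

end core

lemma niceP_clamp {Ω : Type*} {mΩ : MeasurableSpace Ω} {𝓕 : Filtration ℝ mΩ} {s t : ℝ}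
    (hst : s ≤ t) {u : ℝ → Ω → ℝ} (hu : InD 𝓕 s t u) :
    NiceP (fun r ω => u (max s (min r t)) ω) := by
  refine ⟨?_, fun r ω => hu.2 _ ⟨le_max_left _ _, max_le hst (min_le_right _ _)⟩ ω⟩
  have h := (hu.1 t).measurable
  have h' : Measurable (fun p : Set.Iic t × Ω => u p.1 p.2) :=
    h.mono (sup_le_sup_left (MeasurableSpace.comap_mono (𝓕.le t)) _) le_rfl
  have hm : Measurable (fun p : ℝ × Ω =>
      ((⟨max s (min p.1 t), max_le hst (min_le_right _ _)⟩ : Set.Iic t), p.2)) := by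
    refine Measurable.prodMk (Measurable.subtype_mk ?_) measurable_snd
    fun_prop
  exact h'.comp hm

lemma zeta_summable {β : ℕ → ℝ} (hβ : ValidBeta β) {r : ℝ} (hr : r ∈ Icc (0 : ℝ) 1) :
    Summable fun p : ℕ => (p : ℝ) * ((p : ℝ) - 1) * β p ^ 2 * r ^ (p - 2) := by
  have hb : ∃ M : ℝ, ∀ p : ℕ, (p : ℝ) ^ 2 * (1 / 2 : ℝ) ^ p ≤ M := by
    have := (summable_pow_mul_geometric_of_norm_lt_one (R := ℝ) 2 (r := 1 / 2)
      (by norm_num)).tendsto_atTop_zero.bddAbove_range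
    obtain ⟨M, hM⟩ := this
    exact ⟨M, fun p => hM ⟨p, rfl⟩⟩
  obtain ⟨M, hM⟩ := hb
  refine Summable.of_norm_bounded (hβ.2.2.2.2.mul_left M) fun p => ?_
  have h1 : (p : ℝ) ^ 2 ≤ M * 2 ^ p := by
    have := mul_le_mul_of_nonneg_right (hM p) (by positivity : (0 : ℝ) ≤ 2 ^ p)
    rwa [mul_assoc, ← mul_pow, show (1 / 2 * 2 : ℝ) = 1 by norm_num, one_pow, mul_one] at this
  have h2 : |(p : ℝ) * ((p : ℝ) - 1)| ≤ (p : ℝ) ^ 2 := by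
    rcases Nat.eq_zero_or_pos p with rfl | hp
    · simp
    · have : (1 : ℝ) ≤ p := by exact_mod_cast hp
      rw [abs_of_nonneg (by nlinarith)]; nlinarith
  have h3 : |r ^ (p - 2)| ≤ 1 := by
    rw [abs_pow, abs_of_nonneg hr.1]; exact pow_le_one₀ hr.1 hr.2
  rw [Real.norm_eq_abs, abs_mul, abs_mul, abs_of_nonneg (sq_nonneg (β p))]
  calc |(p : ℝ) * ((p : ℝ) - 1)| * β p ^ 2 * |r ^ (p - 2)|
      ≤ (M * 2 ^ p) * β p ^ 2 * 1 := by
        exact mul_le_mul (mul_le_mul_of_nonneg_right (h2.trans h1) (sq_nonneg _)) h3 (abs_nonneg _)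
          (mul_nonneg ((sq_nonneg _).trans h1) (sq_nonneg _))
    _ = M * (2 ^ p * β p ^ 2) := by ring

lemma zeta_coef (β : ℕ → ℝ) (p : ℕ) : 0 ≤ (p : ℝ) * ((p : ℝ) - 1) * β p ^ 2 := by
  rcases Nat.eq_zero_or_pos p with rfl | hp
  · simp
  · have : (1 : ℝ) ≤ p := by exact_mod_cast hp
    have : 0 ≤ (p : ℝ) - 1 := by linarith
    positivity

lemma zeta_mono {β : ℕ → ℝ} (hβ : ValidBeta β) {a b : ℝ} (ha : 0 ≤ a) (hab : a ≤ b)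
    (hb : b ≤ 1) : zetaFn β a ≤ zetaFn β b :=
  Summable.tsum_le_tsum
    (fun p => mul_le_mul_of_nonneg_left (pow_le_pow_left₀ ha hab _) (zeta_coef β p))
    (zeta_summable hβ ⟨ha, hab.trans hb⟩) (zeta_summable hβ ⟨ha.trans hab, hb⟩)

lemma zeta_pos {β : ℕ → ℝ} (hβ : ValidBeta β) {a : ℝ} (ha : 0 < a) (ha1 : a ≤ 1) :
    0 < zetaFn β a := by
  obtain ⟨p, hp, hpb⟩ := hβ.2.2.2.1
  refine (zeta_summable hβ ⟨ha.le, ha1⟩).tsum_pos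
    (fun i => mul_nonneg (zeta_coef β i) (by positivity)) p ?_
  have : (2 : ℝ) ≤ p := by exact_mod_cast hp
  have : 0 < (p : ℝ) - 1 := by linarith
  positivity

lemma xiD_nonneg (β : ℕ → ℝ) {a : ℝ} (ha : 0 ≤ a) : 0 ≤ xiD β a :=
  tsum_nonneg fun p => by positivity

lemma bm_integrable {Ω : Type*} [MeasurableSpace Ω] {P : Measure Ω} {B : ℝ → Ω → ℝ}
    (hB : IsStdBM P B) {a : ℝ} (ha : 0 ≤ a) : Integrable (B a) P := by
  have h := hB.2.2.2.1 0 a le_rfl ha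
  have hm : Measurable (fun ω => B a ω - B 0 ω) := (hB.1 a).sub (hB.1 0)
  have h1 : Integrable (fun z : ℝ => z) (Measure.map (fun ω => B a ω - B 0 ω) P) := by
    rw [h]
    exact (memLp_id_gaussianReal 1).integrable (by simp)
  have h2 : Integrable (fun ω => B a ω - B 0 ω) P := h1.comp_measurable hm
  refine h2.congr ?_
  filter_upwards [hB.2.1] with ω hω
  simp [hω]

/-- **Strict concavity of `F^{s,t}(·,x)` (proof of Proposition 3).** If
`0 < s < t ≤ 1`, `α(s) > 0` and `∫_s^t α(r)ζ(r) dr < 1`, then `F^{s,t}(·,x)` is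
strictly concave on `𝓓[s,t]`. -/
theorem stmt14 {Ω : Type*} [mΩ : MeasurableSpace Ω] (P : Measure Ω) [IsProbabilityMeasure P]
    (β : ℕ → ℝ) (hβ : ValidBeta β)
    (Φ : Measure ℝ → ℝ → ℝ → ℝ) (hΦ : IsParisiFamily β Φ)
    (B : ℝ → Ω → ℝ) (hB : IsStdBM P B)
    (𝓕 : Filtration ℝ mΩ)
    (h𝓕 : ∀ r : ℝ, (𝓕 r : MeasurableSpace Ω)
      = ⨆ v ∈ Icc (0 : ℝ) r, MeasurableSpace.comap (fun ω => B (xiD β v) ω) inferInstance)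
    (μ : Measure ℝ) (hμ : MemM μ)
    (s t : ℝ) (hs : 0 < s) (hst : s < t) (ht : t ≤ 1)
    (hαs : 0 < distF μ s)
    (hsmall : (∫ r in s..t, distF μ r * zetaFn β r) < 1) (x : ℝ)
    (u₀ u₁ : ℝ → Ω → ℝ) (hu₀ : InD 𝓕 s t u₀) (hu₁ : InD 𝓕 s t u₁)
    (hne : 0 < normD P s t (fun r ω => u₀ r ω - u₁ r ω))
    (l : ℝ) (hl : l ∈ Ioo (0 : ℝ) 1) :
    (1 - l) * Ffn P β μ (Φ μ) (fun r => B (xiD β r)) s t u₀ x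
        + l * Ffn P β μ (Φ μ) (fun r => B (xiD β r)) s t u₁ x
      < Ffn P β μ (Φ μ) (fun r => B (xiD β r)) s t
          (fun r ω => (1 - l) * u₀ r ω + l * u₁ r ω) x := by
  have hμ1 := hμ.1
  have hclamp : ∀ r ∈ Set.uIcc s t, max s (min r t) = r := by
    intro r hr
    rw [Set.uIcc_of_le hst.le] at hr
    rw [min_eq_left hr.2, max_eq_right hr.1]
  have hcs : ∀ r, s ≤ max s (min r t) := fun r => le_max_left _ _
  have hct : ∀ r, max s (min r t) ≤ t := fun r => max_le hst.le (min_le_right _ _)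
  have hcm : Monotone fun r : ℝ => max s (min r t) := fun a b h =>
    max_le_max le_rfl (min_le_min h le_rfl)
  set k : ℝ → ℝ := fun r => distF μ (max s (min r t)) * zetaFn β (max s (min r t)) with hk
  have hζs := zeta_pos hβ hs (hst.le.trans ht)
  have hkm : Measurable k := by
    refine Measurable.mul ((distF_mono μ).comp hcm).measurable (Monotone.measurable ?_)
    intro a b h
    exact zeta_mono hβ (hs.le.trans (hcs a)) (hcm h) ((hct b).trans ht)
  have hmain := core_ineq P hkm (c := distF μ s * zetaFn β s) (C := 1 * zetaFn β t)
    (mul_pos hαs hζs)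
    (fun r => mul_le_mul (distF_mono μ (hcs r)) (zeta_mono hβ hs.le (hcs r) ((hct r).trans ht))
      hζs.le (distF_nonneg _ _))
    (fun r => mul_le_mul (distF_le_one μ _)
      (zeta_mono hβ (hs.le.trans (hcs r)) (hct r) ht)
      (zeta_pos hβ (hs.trans_le (hcs r)) ((hct r).trans ht)).le zero_le_one)
    hst (by
      rw [intervalIntegral.integral_congr (g := fun r => distF μ r * zetaFn β r)
        (fun r hr => by simp only [hk, hclamp r hr])]
      exact hsmall) x (niceP_clamp hst.le hu₀) (niceP_clamp hst.le hu₁)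
    (goodFn_parisi hΦ hμ (t := t) ⟨hs.le.trans hst.le, ht⟩)
    (G := fun ω => B (xiD β t) ω - B (xiD β s) ω)
    ((hB.1 _).sub (hB.1 _))
    ((bm_integrable hB (xiD_nonneg β (hs.le.trans hst.le))).sub
      (bm_integrable hB (xiD_nonneg β hs.le)))
    (by
      have h := Real.sqrt_pos.1 hne
      refine h.trans_eq ?_
      congr 1; ext ω
      exact intervalIntegral.integral_congr fun r hr => by simp only [hclamp r hr]) hl
  have c1 : ∀ v : ℝ → Ω → ℝ, ∀ ω, ∫ r in s..t, distF μ r * zetaFn β r * v r ω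
      = ∫ r in s..t, k r * v (max s (min r t)) ω := fun v ω =>
    intervalIntegral.integral_congr fun r hr => by simp only [hk, hclamp r hr]
  have c2 : ∀ v : ℝ → Ω → ℝ, ∀ ω, ∫ r in s..t, distF μ r * zetaFn β r * (v r ω) ^ 2
      = ∫ r in s..t, k r * (v (max s (min r t)) ω) ^ 2 := fun v ω =>
    intervalIntegral.integral_congr fun r hr => by simp only [hk, hclamp r hr]
  unfold Ffn
  simp only [c1 u₀, c1 u₁, c1 (fun r ω => (1 - l) * u₀ r ω + l * u₁ r ω), c2 u₀, c2 u₁,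
    c2 (fun r ω => (1 - l) * u₀ r ω + l * u₁ r ω)]
  exact hmain


end
end
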